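/- arXiv:math/0510071 — 3 statements merged into one kernel-verified Lean document; each statement's English description precedes it below -/
import Mathlib

section
/- Let μ : ℂ → ℂ be a C^∞ doubly periodic function with |μ(z)| < 1 for all z. Then there exist complex numbers ω₁, ω₂, linearly independent over ℝ, and a C^∞ diffeomorphism Φ : ℂ → ℂ such that Φ(z + 2π) = Φ(z) + ω₁ and Φ(z + 2πi) = Φ(z) + ω₂ for all z, and ∂Φ/∂z̄ = μ·∂Φ/∂z everywhere on ℂ. (Equivalently: every C^∞ almost complex structure on the two-torus is transformed by a diffeomorphism to the standard structure on some complex torus ℂ/(ω₁ℤ + ω₂ℤ).) -/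
open MeasureTheory

/-- The Wirtinger derivative `∂f/∂z = (1/2)(∂f/∂x − i ∂f/∂y)` of `f` at `z`,
where `∂f/∂x`, `∂f/∂y` are the directional derivatives in directions `1`, `i`. -/
noncomputable def wderiv (f : ℂ → ℂ) (z : ℂ) : ℂ :=
  (fderiv ℝ f z 1 - Complex.I * fderiv ℝ f z Complex.I) / 2

/-- The Wirtinger derivative `∂f/∂z̄ = (1/2)(∂f/∂x + i ∂f/∂y)` of `f` at `z`. -/
noncomputable def wderivBar (f : ℂ → ℂ) (z : ℂ) : ℂ :=
  (fderiv ℝ f z 1 + Complex.I * fderiv ℝ f z Complex.I) / 2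

/-- A function on `ℂ` is doubly periodic (with periods `2π` and `2πi`). -/
def DoublyPeriodic (f : ℂ → ℂ) : Prop :=
  ∀ z : ℂ, f (z + 2 * Real.pi) = f z ∧ f (z + 2 * Real.pi * Complex.I) = f z



theorem proper_bijective (Φ : ℂ → ℂ) (hΦ : ContDiff ℝ (⊤ : ℕ∞) Φ)
    (e : ℂ → (ℂ ≃L[ℝ] ℂ)) (he : ∀ z, HasFDerivAt Φ (e z : ℂ →L[ℝ] ℂ) z)
    (hprop : Filter.Tendsto Φ (Filter.cocompact ℂ) (Filter.cocompact ℂ)) :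
    Function.Bijective Φ ∧ ContDiff ℝ (⊤ : ℕ∞) (Function.invFun Φ) := by
  have hc : Continuous Φ := hΦ.continuous
  have hp : IsProperMap Φ := isProperMap_iff_tendsto_cocompact.2 ⟨hc, hprop⟩
  have hloc : ∀ z, ∃ φ : OpenPartialHomeomorph ℂ ℂ, z ∈ φ.source ∧ φ = Φ := by
    intro z
    have h1 : ContDiffAt ℝ (⊤ : ℕ∞) Φ z := hΦ.contDiffAt
    refine ⟨h1.toOpenPartialHomeomorph Φ (he z) (by simp), ?_, ?_⟩
    · exact h1.mem_toOpenPartialHomeomorph_source (he z) (by simp)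
    · exact h1.toOpenPartialHomeomorph_coe (he z) (by simp)
  have hlh : IsLocalHomeomorph Φ := fun z => by
    obtain ⟨φ, h1, h2⟩ := hloc z
    exact ⟨φ, h1, h2.symm⟩
  have hcov : IsCoveringMap Φ := by
    intro x
    have hfin : (Φ ⁻¹' {x}).Finite :=
      (hp.isCompact_preimage isCompact_singleton).finite
        (.of_openPartialHomeomorph Φ subset_rfl (fun z _ => hloc z))
    have := hp.isClosedMap.isEvenlyCovered_of_openPartialHomeomorph hfin
      (fun z _ => hloc z)
    exact this
  have hinj : Function.Injective Φ := by
    intro z w hzw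
    obtain ⟨F, ⟨hF1, hF2⟩, -⟩ := hcov.existsUnique_continuousMap_lifts (ContinuousMap.id ℂ)
      (Φ z) z rfl
    have key : F ∘ Φ = id := by
      apply hcov.eq_of_comp_eq (F.continuous.comp hc) continuous_id (by
        rw [← Function.comp_assoc, hF2]; rfl) z (by simpa using hF1)
    have h1 := congrFun key z
    have h2 := congrFun key w
    simp only [Function.comp_apply, id] at h1 h2
    rw [← h1, ← h2, hzw]
  have hsurj : Function.Surjective Φ := by
    have h1 : IsClopen (Set.range Φ) := ⟨hp.isClosedMap.isClosed_range, hlh.isOpenMap.isOpen_range⟩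
    rw [← Set.range_eq_univ]
    exact h1.eq_univ (Set.range_nonempty Φ)
  refine ⟨⟨hinj, hsurj⟩, ?_⟩
  let H : ℂ ≃ₜ ℂ := (Equiv.ofBijective Φ ⟨hinj, hsurj⟩).toHomeomorphOfContinuousOpen hc hlh.isOpenMap
  have hs : ContDiff ℝ (⊤ : ℕ∞) H.symm := H.contDiff_symm (f₀' := e) he hΦ
  have : Function.invFun Φ = H.symm := by
    funext w
    apply hinj
    rw [Function.invFun_eq (hsurj w)]
    exact (H.apply_symm_apply w).symm
  rw [this]; exact hs


/-- Double periodicity, any codomain. -/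
def DP {E : Type*} (f : ℂ → E) : Prop :=
  ∀ z : ℂ, f (z + 2 * Real.pi) = f z ∧ f (z + 2 * Real.pi * Complex.I) = f z

theorem cont_zero (k : ℝ → ℝ) (hk : Continuous k) (a b : ℝ) (hab : a < b) (hn : ∀ x, 0 ≤ k x)
    (hi : ∫ x in a..b, k x = 0) : k a = 0 := by
  by_contra h
  have := intervalIntegral.integral_pos hab hk.continuousOn (fun x _ => hn x)
    ⟨a, ⟨le_rfl, hab.le⟩, lt_of_le_of_ne (hn a) (Ne.symm h)⟩
  linarith

theorem div_zero_of_nonneg (A B : ℂ → ℝ) (hA : ContDiff ℝ 1 A) (hB : ContDiff ℝ 1 B)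
    (pA : DP A) (pB : DP B)
    (hn : ∀ z, 0 ≤ fderiv ℝ A z 1 + fderiv ℝ B z Complex.I) (z : ℂ) :
    fderiv ℝ A z 1 + fderiv ℝ B z Complex.I = 0 := by
  let L : ℝ × ℝ →L[ℝ] ℂ := Complex.equivRealProdCLM.symm
  have hL : ∀ x y : ℝ, L (x, y) = x + y * Complex.I := fun x y =>
    Complex.equivRealProdCLM_symm_apply (x, y)
  have hL' : ∀ q : ℝ × ℝ, L q = q.1 + q.2 * Complex.I := fun q => hL q.1 q.2
  have L10 : L (1, 0) = 1 := by rw [hL]; simp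
  have L01 : L (0, 1) = Complex.I := by rw [hL]; simp
  have dA : ∀ q, HasFDerivAt (A ∘ L) ((fderiv ℝ A (L q)).comp L) q := fun q =>
    ((hA.differentiable (by simp)) (L q)).hasFDerivAt.comp q L.hasFDerivAt
  have dB : ∀ q, HasFDerivAt (B ∘ L) ((fderiv ℝ B (L q)).comp L) q := fun q =>
    ((hB.differentiable (by simp)) (L q)).hasFDerivAt.comp q L.hasFDerivAt
  let h : ℝ × ℝ → ℝ := fun q => fderiv ℝ A (L q) 1 + fderiv ℝ B (L q) Complex.I
  have hh : Continuous h := by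
    have cA := hA.continuous_fderiv (by simp)
    have cB := hB.continuous_fderiv (by simp)
    have := L.continuous
    fun_prop
  have key := integral2_divergence_prod_of_hasFDerivAt (A ∘ L) (B ∘ L)
    (fun q => (fderiv ℝ A (L q)).comp L) (fun q => (fderiv ℝ B (L q)).comp L)
    z.re z.im (z.re + 2 * Real.pi) (z.im + 2 * Real.pi)
    (hA.continuous.comp L.continuous).continuousOn
    (hB.continuous.comp L.continuous).continuousOn
    (fun q _ => dA q) (fun q _ => dB q)
    (by
      simp only [ContinuousLinearMap.comp_apply, L10, L01]
      exact (hh.continuousOn).integrableOn_compact (isCompact_uIcc.prod isCompact_uIcc))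
  simp only [ContinuousLinearMap.comp_apply, L10, L01, Function.comp_apply] at key
  have e1 : ∀ x : ℝ, B (L (x, z.im + 2 * Real.pi)) = B (L (x, z.im)) := fun x => by
    rw [hL, hL, ← (pB (x + z.im * Complex.I)).2]; congr 1; push_cast; ring
  have e2 : ∀ y : ℝ, A (L (z.re + 2 * Real.pi, y)) = A (L (z.re, y)) := fun y => by
    rw [hL, hL, ← (pA (z.re + y * Complex.I)).1]; congr 1; push_cast; ring
  simp only [e1, e2, sub_self, zero_add] at key
  have hpi := Real.pi_pos
  have k1 := cont_zero (fun x => ∫ y in z.im..(z.im + 2 * Real.pi), h (x, y))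
    (intervalIntegral.continuous_parametric_intervalIntegral_of_continuous' (by fun_prop) _ _)
    z.re (z.re + 2 * Real.pi) (by linarith)
    (fun x => intervalIntegral.integral_nonneg (by linarith) (fun y _ => hn _)) key
  have k2 := cont_zero (fun y => h (z.re, y)) (by fun_prop) z.im (z.im + 2 * Real.pi)
    (by linarith) (fun y => hn _) k1
  have : L (z.re, z.im) = z := by rw [hL]; exact Complex.re_add_im z
  simpa [h, this] using k2

theorem snd_symm (f : ℂ → ℂ) (hf : ContDiff ℝ (⊤ : ℕ∞) f) (z u v : ℂ) :
    fderiv ℝ (fun w => fderiv ℝ f w v) z u = fderiv ℝ (fun w => fderiv ℝ f w u) z v := by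
  have hd : DifferentiableAt ℝ (fderiv ℝ f) z :=
    ((hf.fderiv_right (m := 1) (by norm_cast)).differentiable (by simp)) z
  have h := (hf.contDiffAt (x := z)).isSymmSndFDerivAt (by simp; exact WithTop.coe_le_coe.2 (le_top : (2 : ℕ∞) ≤ ⊤))
  have e : ∀ v u, fderiv ℝ (fun w => fderiv ℝ f w v) z u = fderiv ℝ (fderiv ℝ f) z u v := by
    intro v u
    rw [fderiv_clm_apply hd (differentiableAt_const v)]
    simp
  rw [e, e]; exact h u v

theorem smooth_dir {f : ℂ → ℂ} (hf : ContDiff ℝ (⊤ : ℕ∞) f) (v : ℂ) :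
    ContDiff ℝ (⊤ : ℕ∞) (fun w => fderiv ℝ f w v) :=
  (hf.fderiv_right (m := (⊤ : ℕ∞)) (by simp)).clm_apply contDiff_const

theorem dp_dir {f : ℂ → ℂ} (hf : DP f) (v : ℂ) : DP (fun w => fderiv ℝ f w v) := by
  intro z
  have h1 : (fun w => f (w + 2 * Real.pi)) = f := funext fun w => (hf w).1
  have h2 : (fun w => f (w + 2 * Real.pi * Complex.I)) = f := funext fun w => (hf w).2
  constructor
  · have := fderiv_comp_add_right (𝕜 := ℝ) (f := f) (x := z) (2 * Real.pi : ℂ)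
    rw [h1] at this; simp only [this]
  · have := fderiv_comp_add_right (𝕜 := ℝ) (f := f) (x := z) (2 * Real.pi * Complex.I : ℂ)
    rw [h2] at this; simp only [this]

/-- Main integral identity, in "nonnegative implies zero" form. -/
theorem jac_zero (p : ℂ → ℂ) (hp : ContDiff ℝ (⊤ : ℕ∞) p) (pp : DP p) (c1 c2 c3 c4 d1 d2 : ℝ)
    (h : ℂ → ℝ)
    (hh : ∀ z, h z = (fderiv ℝ p z 1).re * (fderiv ℝ p z Complex.I).im
        - (fderiv ℝ p z Complex.I).re * (fderiv ℝ p z 1).im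
        + (c1 * (fderiv ℝ p z 1).re + c2 * (fderiv ℝ p z 1).im)
        + (c3 * (fderiv ℝ p z Complex.I).re + c4 * (fderiv ℝ p z Complex.I).im)
        + d1 * (2 * (p z).re * (fderiv ℝ p z 1).re + 2 * (p z).im * (fderiv ℝ p z 1).im)
        + d2 * (2 * (p z).re * (fderiv ℝ p z Complex.I).re
            + 2 * (p z).im * (fderiv ℝ p z Complex.I).im))
    (hn : ∀ z, 0 ≤ h z) : ∀ z, h z = 0 := by
  set P := fun w => fderiv ℝ p w 1 with hP
  set Q := fun w => fderiv ℝ p w Complex.I with hQ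
  have sP : ContDiff ℝ (⊤ : ℕ∞) P := smooth_dir hp 1
  have sQ : ContDiff ℝ (⊤ : ℕ∞) Q := smooth_dir hp Complex.I
  have pP : DP P := dp_dir pp 1
  have pQ : DP Q := dp_dir pp Complex.I
  have re_s : ∀ {f : ℂ → ℂ}, ContDiff ℝ (⊤ : ℕ∞) f → ContDiff ℝ (⊤ : ℕ∞) (fun z => (f z).re) :=
    fun hf => Complex.reCLM.contDiff.comp hf
  have im_s : ∀ {f : ℂ → ℂ}, ContDiff ℝ (⊤ : ℕ∞) f → ContDiff ℝ (⊤ : ℕ∞) (fun z => (f z).im) :=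
    fun hf => Complex.imCLM.contDiff.comp hf
  have re_d : ∀ {f : ℂ → ℂ} (_ : ContDiff ℝ (⊤ : ℕ∞) f) (z : ℂ), HasFDerivAt (fun z => (f z).re)
      (Complex.reCLM.comp (fderiv ℝ f z)) z := fun hf z =>
    Complex.reCLM.hasFDerivAt.comp z ((hf.differentiable (by simp)) z).hasFDerivAt
  have im_d : ∀ {f : ℂ → ℂ} (_ : ContDiff ℝ (⊤ : ℕ∞) f) (z : ℂ), HasFDerivAt (fun z => (f z).im)
      (Complex.imCLM.comp (fderiv ℝ f z)) z := fun hf z =>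
    Complex.imCLM.hasFDerivAt.comp z ((hf.differentiable (by simp)) z).hasFDerivAt
  let A : ℂ → ℝ := fun z => (p z).re * (Q z).im + (c1 * (p z).re + c2 * (p z).im)
    + d1 * ((p z).re * (p z).re + (p z).im * (p z).im)
  let B : ℂ → ℝ := fun z => -((p z).re * (P z).im) + (c3 * (p z).re + c4 * (p z).im)
    + d2 * ((p z).re * (p z).re + (p z).im * (p z).im)
  have sA : ContDiff ℝ (⊤ : ℕ∞) A :=
    (((re_s hp).mul (im_s sQ)).add ((contDiff_const.mul (re_s hp)).add
      (contDiff_const.mul (im_s hp)))).add (contDiff_const.mul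
      (((re_s hp).mul (re_s hp)).add ((im_s hp).mul (im_s hp))))
  have sB : ContDiff ℝ (⊤ : ℕ∞) B :=
    ((((re_s hp).mul (im_s sP)).neg).add ((contDiff_const.mul (re_s hp)).add
      (contDiff_const.mul (im_s hp)))).add (contDiff_const.mul
      (((re_s hp).mul (re_s hp)).add ((im_s hp).mul (im_s hp))))
  have key : ∀ z, fderiv ℝ A z 1 + fderiv ℝ B z Complex.I = h z := by
    intro z
    have hA := ((((re_d hp z).mul (im_d sQ z)).add (((re_d hp z).const_mul c1).add
      ((im_d hp z).const_mul c2))).add ((((re_d hp z).mul (re_d hp z)).add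
        ((im_d hp z).mul (im_d hp z))).const_mul d1)).fderiv
    have hB := ((((re_d hp z).mul (im_d sP z)).neg.add (((re_d hp z).const_mul c3).add
      ((im_d hp z).const_mul c4))).add ((((re_d hp z).mul (re_d hp z)).add
        ((im_d hp z).mul (im_d hp z))).const_mul d2)).fderiv
    have hA' : fderiv ℝ A z = _ := hA
    have hB' : fderiv ℝ B z = _ := hB
    have hs : fderiv ℝ Q z 1 = fderiv ℝ P z Complex.I := snd_symm p hp z 1 Complex.I
    rw [hA', hB', hh]
    simp [hs]
    simp [hP, hQ]
    ring
  intro z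
  rw [← key]
  refine div_zero_of_nonneg A B (sA.of_le (by simp)) (sB.of_le (by simp)) ?_ ?_
    (fun z => by rw [key]; exact hn z) z
  · intro z; simp only [A, (pp z).1, (pp z).2, (pQ z).1, (pQ z).2, and_self]
  · intro z; simp only [B, (pp z).1, (pp z).2, (pP z).1, (pP z).2, and_self]


theorem fderiv_eq_w (f : ℂ → ℂ) (z v : ℂ) :
    fderiv ℝ f z v = wderiv f z * v + wderivBar f z * (starRingEnd ℂ v) := by
  have h : v = v.re • (1 : ℂ) + v.im • Complex.I := by
    simp [Complex.re_add_im]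
  have h2 : fderiv ℝ f z v = v.re * fderiv ℝ f z 1 + v.im * fderiv ℝ f z Complex.I := by
    conv_lhs => rw [h]
    rw [map_add, map_smul, map_smul]; simp
  have h3 : v = v.re + v.im * Complex.I := (Complex.re_add_im v).symm
  have h4 : starRingEnd ℂ v = v.re - v.im * Complex.I := by
    apply Complex.ext <;> simp
  rw [h2, h4]
  conv_rhs => rw [h3]
  unfold wderiv wderivBar
  have hI := Complex.I_mul_I
  generalize fderiv ℝ f z 1 = P
  generalize fderiv ℝ f z Complex.I = Q
  simp only [Complex.add_re, Complex.add_im, Complex.mul_re, Complex.mul_im, Complex.ofReal_re,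
    Complex.ofReal_im, Complex.I_re, Complex.I_im]
  ring_nf
  rw [Complex.I_sq]; ring

theorem w_of_hasFDerivAt {f : ℂ → ℂ} {z a b : ℂ} {L : ℂ →L[ℝ] ℂ} (hf : HasFDerivAt f L z)
    (h1 : L 1 = a + b) (h2 : L Complex.I = Complex.I * (a - b)) :
    wderiv f z = a ∧ wderivBar f z = b := by
  unfold wderiv wderivBar
  rw [hf.fderiv, h1, h2]
  constructor
  · linear_combination (-(a - b) / 2) * Complex.I_mul_I
  · linear_combination ((a - b) / 2) * Complex.I_mul_I

theorem fd1 (f : ℂ → ℂ) (z : ℂ) : fderiv ℝ f z 1 = wderiv f z + wderivBar f z := by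
  rw [fderiv_eq_w]; simp

theorem fdI (f : ℂ → ℂ) (z : ℂ) :
    fderiv ℝ f z Complex.I = Complex.I * (wderiv f z - wderivBar f z) := by
  rw [fderiv_eq_w]; simp; ring

theorem w_add {f g : ℂ → ℂ} {z : ℂ} (hf : DifferentiableAt ℝ f z) (hg : DifferentiableAt ℝ g z) :
    wderiv (fun w => f w + g w) z = wderiv f z + wderiv g z ∧
    wderivBar (fun w => f w + g w) z = wderivBar f z + wderivBar g z := by
  refine w_of_hasFDerivAt (hf.hasFDerivAt.add hg.hasFDerivAt) ?_ ?_
  · simp [fd1]; ring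
  · simp [fdI]; ring

theorem w_mul {f g : ℂ → ℂ} {z : ℂ} (hf : DifferentiableAt ℝ f z) (hg : DifferentiableAt ℝ g z) :
    wderiv (fun w => f w * g w) z = wderiv f z * g z + f z * wderiv g z ∧
    wderivBar (fun w => f w * g w) z = wderivBar f z * g z + f z * wderivBar g z := by
  refine w_of_hasFDerivAt (hf.hasFDerivAt.mul hg.hasFDerivAt) ?_ ?_
  · simp [fd1]; ring
  · simp [fdI]; ring

theorem w_const (c z : ℂ) : wderiv (fun _ => c) z = 0 ∧ wderivBar (fun _ => c) z = 0 :=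
  w_of_hasFDerivAt (hasFDerivAt_const c z) (by simp) (by simp)

theorem w_id (z : ℂ) : wderiv (fun w => w) z = 1 ∧ wderivBar (fun w => w) z = 0 :=
  w_of_hasFDerivAt (hasFDerivAt_id z) (by simp) (by simp)

theorem w_conj (z : ℂ) : wderiv (fun w => starRingEnd ℂ w) z = 0 ∧
    wderivBar (fun w => starRingEnd ℂ w) z = 1 :=
  w_of_hasFDerivAt (Complex.conjCLE.toContinuousLinearMap.hasFDerivAt (x := z)) (by simp) (by simp)

theorem w_exp {f : ℂ → ℂ} {z : ℂ} (hf : DifferentiableAt ℝ f z) :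
    wderiv (fun w => Complex.exp (f w)) z = Complex.exp (f z) * wderiv f z ∧
    wderivBar (fun w => Complex.exp (f w)) z = Complex.exp (f z) * wderivBar f z := by
  have h1 : HasFDerivAt (fun w => Complex.exp (f w)) (Complex.exp (f z) • fderiv ℝ f z) z :=
    HasFDerivAt.cexp hf.hasFDerivAt
  refine w_of_hasFDerivAt h1 ?_ ?_
  · simp [fd1]; ring
  · simp [fdI]; ring

theorem smooth_w {f : ℂ → ℂ} (hf : ContDiff ℝ (⊤ : ℕ∞) f) :
    ContDiff ℝ (⊤ : ℕ∞) (wderiv f) ∧ ContDiff ℝ (⊤ : ℕ∞) (wderivBar f) :=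
  ⟨((smooth_dir hf 1).sub (contDiff_const.mul (smooth_dir hf Complex.I))).div_const 2,
   ((smooth_dir hf 1).add (contDiff_const.mul (smooth_dir hf Complex.I))).div_const 2⟩

theorem dp_w {f : ℂ → ℂ} (hf : DP f) : DP (wderiv f) ∧ DP (wderivBar f) := by
  have h1 := dp_dir hf 1
  have h2 := dp_dir hf Complex.I
  simp only [DP] at h1 h2
  constructor <;> intro z <;>
    simp [wderiv, wderivBar, (h1 z).1, (h1 z).2, (h2 z).1, (h2 z).2]

theorem w_comm {f : ℂ → ℂ} (hf : ContDiff ℝ (⊤ : ℕ∞) f) (z : ℂ) :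
    wderivBar (wderiv f) z = wderiv (wderivBar f) z := by
  have d1 := ((smooth_dir hf 1).differentiable (by simp)) z
  have d2 := ((smooth_dir hf Complex.I).differentiable (by simp)) z
  have e1 : HasFDerivAt (wderiv f) _ z :=
    (d1.hasFDerivAt.sub (d2.hasFDerivAt.const_mul Complex.I)).mul_const (2 : ℂ)⁻¹
  have e2 : HasFDerivAt (wderivBar f) _ z :=
    (d1.hasFDerivAt.add (d2.hasFDerivAt.const_mul Complex.I)).mul_const (2 : ℂ)⁻¹
  rw [wderivBar, e1.fderiv, wderiv, e2.fderiv]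
  have hs := snd_symm f hf z 1 Complex.I
  simp [hs]
  ring

theorem w_zero_const {f : ℂ → ℂ} (hf : Differentiable ℝ f) (h1 : ∀ z, wderiv f z = 0)
    (h2 : ∀ z, wderivBar f z = 0) (x y : ℂ) : f x = f y := by
  apply is_const_of_fderiv_eq_zero (𝕜 := ℝ) hf
  intro z
  ext v
  all_goals simp [fderiv_eq_w, h1, h2]

theorem dp_reduce (z : ℂ) : ∃ w ∈ Metric.closedBall (0 : ℂ) (4 * Real.pi),
    ∀ {E : Type} (f : ℂ → E), DP f → f z = f w := by
  have hpi := Real.pi_pos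
  set m := ⌊z.re / (2 * Real.pi)⌋
  set n := ⌊z.im / (2 * Real.pi)⌋
  refine ⟨z - m • (2 * Real.pi : ℂ) - n • (2 * Real.pi * Complex.I), ?_, ?_⟩
  · rw [mem_closedBall_zero_iff]
    refine (Complex.norm_le_abs_re_add_abs_im _).trans ?_
    have a1 := Int.floor_le (z.re / (2 * Real.pi))
    have a2 := (Int.lt_floor_add_one (z.re / (2 * Real.pi))).le
    have b1 := Int.floor_le (z.im / (2 * Real.pi))
    have b2 := (Int.lt_floor_add_one (z.im / (2 * Real.pi))).le
    rw [le_div_iff₀ (by positivity)] at a1 b1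
    rw [div_le_iff₀ (by positivity)] at a2 b2
    have c1 : |z.re - m * (2 * Real.pi)| ≤ 2 * Real.pi := by
      rw [abs_le]; constructor <;> nlinarith
    have c2 : |z.im - n * (2 * Real.pi)| ≤ 2 * Real.pi := by
      rw [abs_le]; constructor <;> nlinarith
    simp
    linarith
  · intro E f hf
    have p1 : Function.Periodic f (2 * Real.pi : ℂ) := fun z => (hf z).1
    have p2 : Function.Periodic f (2 * Real.pi * Complex.I : ℂ) := fun z => (hf z).2
    rw [p2.sub_zsmul_eq, p1.sub_zsmul_eq]

theorem dp_bdd {f : ℂ → ℂ} (hf : Continuous f) (pf : DP f) : ∃ w, ∀ z, ‖f z‖ ≤ ‖f w‖ := by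
  obtain ⟨w, -, hw⟩ := (isCompact_closedBall (0 : ℂ) (4 * Real.pi)).exists_isMaxOn
    ⟨0, by simp [Real.pi_pos.le]⟩ (hf.norm.continuousOn)
  refine ⟨w, fun z => ?_⟩
  obtain ⟨v, hv, h⟩ := dp_reduce z
  rw [h f pf]; exact hw hv



noncomputable def ee (n : Fin 2 → ℤ) (z : ℂ) : ℂ :=
  Complex.exp (Complex.I * ((n 0 : ℝ) * (z.re : ℂ) + (n 1 : ℝ) * (z.im : ℂ)))

/-- size of a lattice point -/
noncomputable def sz (n : Fin 2 → ℤ) : ℝ := 1 + |(n 0 : ℝ)| + |(n 1 : ℝ)|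

/-- rapidly decaying sequences -/
def RD (b : (Fin 2 → ℤ) → ℂ) : Prop := ∀ k : ℕ, Summable (fun n => sz n ^ k * ‖b n‖)

/-- Fourier synthesis -/
noncomputable def syn (b : (Fin 2 → ℤ) → ℂ) (z : ℂ) : ℂ := ∑' n, b n * ee n z

theorem ee_norm (n : Fin 2 → ℤ) (z : ℂ) : ‖ee n z‖ = 1 := by
  unfold ee
  rw [show Complex.I * (((n 0 : ℝ) : ℂ) * (z.re : ℂ) + ((n 1 : ℝ) : ℂ) * (z.im : ℂ))
    = (((n 0 : ℝ) * z.re + (n 1 : ℝ) * z.im : ℝ) : ℂ) * Complex.I by push_cast; ring]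
  exact Complex.norm_exp_ofReal_mul_I _

theorem sz_pos (n : Fin 2 → ℤ) : 1 ≤ sz n := by
  unfold sz; have := abs_nonneg (n 0 : ℝ); have := abs_nonneg (n 1 : ℝ); linarith

theorem RD.summable {b : (Fin 2 → ℤ) → ℂ} (hb : RD b) : Summable (fun n => ‖b n‖) := by
  simpa using hb 0

theorem RD.mul {b c : (Fin 2 → ℤ) → ℂ} (hb : RD b) {C : ℝ} {m : ℕ}
    (hc : ∀ n, ‖c n‖ ≤ C * sz n ^ m) : RD (fun n => c n * b n) := by
  intro k
  refine Summable.of_nonneg_of_le (fun n => ?_) (fun n => ?_) ((hb (k + m)).mul_left C)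
  · have := sz_pos n; positivity
  · have := sz_pos n
    rw [norm_mul]
    calc sz n ^ k * (‖c n‖ * ‖b n‖) ≤ sz n ^ k * ((C * sz n ^ m) * ‖b n‖) := by
          gcongr; exact hc n
      _ = _ := by ring

theorem sz_summable : Summable (fun n : Fin 2 → ℤ => (sz n ^ 4)⁻¹) := by
  have h1 : Summable (fun m : ℤ => ((1 + |(m : ℝ)|) ^ 2)⁻¹) := by
    have h2 := (Real.summable_abs_int_rpow (b := 2) (by norm_num))
    refine Summable.of_norm_bounded_eventually h2 ?_
    rw [Filter.eventually_cofinite]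
    refine (Set.finite_singleton (0 : ℤ)).subset ?_
    intro m hm
    by_contra hm0
    apply hm
    have hm1 : 0 < |(m : ℝ)| := by
      simpa using hm0
    rw [Real.norm_of_nonneg (by positivity), Real.rpow_neg (by positivity)]
    rw [Real.rpow_two]
    gcongr
    linarith
  have h3 := h1.mul_of_nonneg h1 (fun _ => by positivity) (fun _ => by positivity)
  have h4 := (Equiv.summable_iff (finTwoArrowEquiv ℤ)).2 h3
  refine Summable.of_nonneg_of_le (fun n => ?_) (fun n => ?_) h4
  · have := sz_pos n; positivity
  · change (sz n ^ 4)⁻¹ ≤ ((1 + |(n 0 : ℝ)|) ^ 2)⁻¹ * ((1 + |(n 1 : ℝ)|) ^ 2)⁻¹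
    rw [← mul_inv]
    have a0 := abs_nonneg (n 0 : ℝ)
    have a1 := abs_nonneg (n 1 : ℝ)
    unfold sz
    apply inv_anti₀ (by positivity)
    rw [← mul_pow]
    rw [show (4 : ℕ) = 2 * 2 by rfl, pow_mul]
    gcongr
    nlinarith

theorem RD_of_bounds {b : (Fin 2 → ℤ) → ℂ}
    (h : ∀ j : Fin 2, ∀ k : ℕ, ∃ C : ℝ, ∀ n, |(n j : ℝ)| ^ k * ‖b n‖ ≤ C) : RD b := by
  intro k
  obtain ⟨A, hA⟩ := h 0 0
  obtain ⟨B, hB⟩ := h 0 (k + 4)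
  obtain ⟨C, hC⟩ := h 1 (k + 4)
  refine Summable.of_nonneg_of_le (fun n => ?_) (fun n => ?_)
    (sz_summable.mul_left (3 ^ (k + 4) * (A + B + C)))
  · have := sz_pos n; positivity
  · have hs := sz_pos n
    have a0 := abs_nonneg (n 0 : ℝ)
    have a1 := abs_nonneg (n 1 : ℝ)
    have hb0 := norm_nonneg (b n)
    have e1 : sz n ^ (k + 4) * ‖b n‖ ≤ 3 ^ (k + 4) * (A + B + C) := by
      have hA' := hA n
      simp only [pow_zero, one_mul] at hA'
      have hB' := hB n
      have hC' := hC n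
      have : sz n ^ (k + 4) ≤ 3 ^ (k + 4) * (1 + |(n 0 : ℝ)| ^ (k + 4) + |(n 1 : ℝ)| ^ (k + 4)) := by
        have p0 : 0 ≤ |(n 0 : ℝ)| ^ (k + 4) := by positivity
        have p1 : 0 ≤ |(n 1 : ℝ)| ^ (k + 4) := by positivity
        have key : ∀ M : ℝ, sz n ≤ 3 * M → M ^ (k + 4) ≤ 
            (1 + |(n 0 : ℝ)| ^ (k + 4) + |(n 1 : ℝ)| ^ (k + 4)) → sz n ^ (k + 4) ≤ 
            3 ^ (k + 4) * (1 + |(n 0 : ℝ)| ^ (k + 4) + |(n 1 : ℝ)| ^ (k + 4)) := by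
          intro M h1 h2
          calc sz n ^ (k + 4) ≤ (3 * M) ^ (k + 4) := by gcongr
            _ = 3 ^ (k + 4) * M ^ (k + 4) := by rw [mul_pow]
            _ ≤ _ := by gcongr
        rcases le_total |(n 0 : ℝ)| |(n 1 : ℝ)| with h01 | h01
        · rcases le_total |(n 1 : ℝ)| 1 with h1 | h1
          · exact key 1 (by unfold sz; linarith) (by rw [one_pow]; linarith)
          · exact key |(n 1 : ℝ)| (by unfold sz; linarith) (by linarith)
        · rcases le_total |(n 0 : ℝ)| 1 with h1 | h1
          · exact key 1 (by unfold sz; linarith) (by rw [one_pow]; linarith)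
          · exact key |(n 0 : ℝ)| (by unfold sz; linarith) (by linarith)
      calc sz n ^ (k + 4) * ‖b n‖ ≤
          (3 ^ (k + 4) * (1 + |(n 0 : ℝ)| ^ (k + 4) + |(n 1 : ℝ)| ^ (k + 4))) * ‖b n‖ := by gcongr
        _ = 3 ^ (k + 4) * (‖b n‖ + |(n 0 : ℝ)| ^ (k + 4) * ‖b n‖ + |(n 1 : ℝ)| ^ (k + 4) * ‖b n‖) := by
          ring
        _ ≤ _ := by gcongr
    rw [← div_eq_mul_inv, le_div_iff₀ (by positivity)]
    calc _ = sz n ^ (k + 4) * ‖b n‖ := by ring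
      _ ≤ _ := e1

theorem ee_hasFDerivAt (n : Fin 2 → ℤ) (z : ℂ) : HasFDerivAt (ee n)
    ((Complex.I * (n 0 : ℝ) * ee n z) • Complex.ofRealCLM.comp Complex.reCLM
      + (Complex.I * (n 1 : ℝ) * ee n z) • Complex.ofRealCLM.comp Complex.imCLM) z := by
  have h1 : HasFDerivAt (fun z : ℂ => (z.re : ℂ)) (Complex.ofRealCLM.comp Complex.reCLM) z :=
    (Complex.ofRealCLM.comp Complex.reCLM).hasFDerivAt
  have h2 : HasFDerivAt (fun z : ℂ => (z.im : ℂ)) (Complex.ofRealCLM.comp Complex.imCLM) z :=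
    (Complex.ofRealCLM.comp Complex.imCLM).hasFDerivAt
  have h3 := (((h1.const_mul ((n 0 : ℝ) : ℂ)).add (h2.const_mul ((n 1 : ℝ) : ℂ))).const_mul
    Complex.I).cexp
  refine h3.congr_fderiv ?_
  apply ContinuousLinearMap.ext
  intro v
  simp [ee]
  ring

theorem syn_hasFDerivAt {b : (Fin 2 → ℤ) → ℂ} (hb : RD b) (z : ℂ) : HasFDerivAt (syn b)
    ((syn (fun n => Complex.I * (n 0 : ℝ) * b n) z) • Complex.ofRealCLM.comp Complex.reCLM
      + (syn (fun n => Complex.I * (n 1 : ℝ) * b n) z) • Complex.ofRealCLM.comp Complex.imCLM) z := by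
  have hs : ∀ c : (Fin 2 → ℤ) → ℂ, RD c → ∀ z, Summable (fun n => c n * ee n z) := by
    intro c hc z
    refine Summable.of_norm ?_
    simpa [ee_norm] using hc.summable
  have r : ∀ j : Fin 2, RD (fun n => Complex.I * (n j : ℝ) * b n) := by
    intro j
    refine hb.mul (C := 1) (m := 1) (fun n => ?_)
    have a0 := abs_nonneg (n 0 : ℝ)
    have a1 := abs_nonneg (n 1 : ℝ)
    rw [norm_mul, Complex.norm_I, Complex.norm_real, Real.norm_eq_abs]
    unfold sz
    fin_cases j <;> simp <;> linarith
  let A : ℂ →L[ℝ] ℂ := Complex.ofRealCLM.comp Complex.reCLM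
  let B : ℂ →L[ℝ] ℂ := Complex.ofRealCLM.comp Complex.imCLM
  have hA : ‖A‖ ≤ 1 := A.opNorm_le_bound zero_le_one (fun v => by
    simpa [A] using Complex.abs_re_le_norm v)
  have hB : ‖B‖ ≤ 1 := B.opNorm_le_bound zero_le_one (fun v => by
    simpa [B] using Complex.abs_im_le_norm v)
  have key := hasFDerivAt_tsum (𝕜 := ℝ) (f := fun n z => b n * ee n z)
    (f' := fun n z => (Complex.I * (n 0 : ℝ) * b n * ee n z) • A +
      (Complex.I * (n 1 : ℝ) * b n * ee n z) • B)
    (u := fun n => ‖Complex.I * (n 0 : ℝ) * b n‖ + ‖Complex.I * (n 1 : ℝ) * b n‖)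
    ((r 0).summable.add (r 1).summable)
    (fun n x => by
      refine ((ee_hasFDerivAt n x).const_mul (b n)).congr_fderiv ?_
      apply ContinuousLinearMap.ext
      intro v
      simp [A, B]
      ring)
    (fun n x => by
      refine (norm_add_le _ _).trans ?_
      gcongr
      · rw [norm_smul, norm_mul _ (ee n x), ee_norm, mul_one]
        exact mul_le_of_le_one_right (norm_nonneg _) hA
      · rw [norm_smul, norm_mul _ (ee n x), ee_norm, mul_one]
        exact mul_le_of_le_one_right (norm_nonneg _) hB)
    (x₀ := 0) (hs b hb 0) z
  refine key.congr_fderiv ?_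
  rw [Summable.tsum_add ((hs _ (r 0) z).smul_const A) ((hs _ (r 1) z).smul_const B),
    (hs _ (r 0) z).tsum_smul_const, (hs _ (r 1) z).tsum_smul_const]
  rfl

theorem RD.mul_j {b : (Fin 2 → ℤ) → ℂ} (hb : RD b) (j : Fin 2) :
    RD (fun n => Complex.I * (n j : ℝ) * b n) := by
  refine hb.mul (C := 1) (m := 1) (fun n => ?_)
  have a0 := abs_nonneg (n 0 : ℝ)
  have a1 := abs_nonneg (n 1 : ℝ)
  rw [norm_mul, Complex.norm_I, Complex.norm_real, Real.norm_eq_abs]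
  unfold sz
  fin_cases j <;> simp <;> linarith

theorem syn_smooth {b : (Fin 2 → ℤ) → ℂ} (hb : RD b) : ContDiff ℝ (⊤ : ℕ∞) (syn b) := by
  rw [contDiff_infty]
  intro k
  induction k generalizing b with
  | zero =>
    simp only [Nat.cast_zero, contDiff_zero]
    exact continuous_iff_continuousAt.2 fun z => (syn_hasFDerivAt hb z).continuousAt
  | succ k ih =>
    push_cast
    rw [contDiff_succ_iff_fderiv]
    refine ⟨fun z => (syn_hasFDerivAt hb z).differentiableAt, by simp, ?_⟩
    rw [show fderiv ℝ (syn b) = _ from funext fun z => (syn_hasFDerivAt hb z).fderiv]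
    exact ((ih (hb.mul_j 0)).smul contDiff_const).add ((ih (hb.mul_j 1)).smul contDiff_const)

theorem ee_per (n : Fin 2 → ℤ) : DP (ee n) := by
  intro z
  constructor
  · unfold ee
    rw [show (Complex.I * (((n 0 : ℝ) : ℂ) * ((z + 2 * Real.pi).re : ℂ) +
      ((n 1 : ℝ) : ℂ) * ((z + 2 * Real.pi).im : ℂ))) = (Complex.I * (((n 0 : ℝ) : ℂ) * (z.re : ℂ) +
      ((n 1 : ℝ) : ℂ) * (z.im : ℂ))) + (n 0) * (2 * Real.pi * Complex.I) by simp; ring]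
    exact Complex.exp_periodic.int_mul (n 0) _
  · unfold ee
    rw [show (Complex.I * (((n 0 : ℝ) : ℂ) * ((z + 2 * Real.pi * Complex.I).re : ℂ) +
      ((n 1 : ℝ) : ℂ) * ((z + 2 * Real.pi * Complex.I).im : ℂ))) =
      (Complex.I * (((n 0 : ℝ) : ℂ) * (z.re : ℂ) +
      ((n 1 : ℝ) : ℂ) * (z.im : ℂ))) + (n 1) * (2 * Real.pi * Complex.I) by simp; ring]
    exact Complex.exp_periodic.int_mul (n 1) _

theorem syn_per (b : (Fin 2 → ℤ) → ℂ) : DP (syn b) := by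
  intro z
  simp only [syn, (ee_per _ z).1, (ee_per _ z).2, and_self]

theorem RD.hs {c : (Fin 2 → ℤ) → ℂ} (hc : RD c) (z : ℂ) : Summable (fun n => c n * ee n z) := by
  refine Summable.of_norm ?_
  simpa [ee_norm] using hc.summable

theorem syn_w {b : (Fin 2 → ℤ) → ℂ} (hb : RD b) (z : ℂ) :
    wderiv (syn b) z = syn (fun n => (Complex.I * (n 0 : ℝ) + (n 1 : ℝ)) / 2 * b n) z ∧
    wderivBar (syn b) z = syn (fun n => (Complex.I * (n 0 : ℝ) - (n 1 : ℝ)) / 2 * b n) z := by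
  have s0 := (hb.mul_j 0).hs z
  have s1 := (hb.mul_j 1).hs z
  unfold wderiv wderivBar
  rw [(syn_hasFDerivAt hb z).fderiv]
  simp only [_root_.add_apply, _root_.smul_apply,
    ContinuousLinearMap.comp_apply, Complex.reCLM_apply, Complex.imCLM_apply,
    Complex.ofRealCLM_apply, Complex.one_re, Complex.one_im, Complex.I_re, Complex.I_im,
    Complex.ofReal_one, Complex.ofReal_zero, smul_eq_mul, mul_one, mul_zero, add_zero, zero_add]
  unfold syn
  rw [← tsum_mul_left, ← Summable.tsum_sub s0 (s1.mul_left _),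
    ← Summable.tsum_add s0 (s1.mul_left _), ← tsum_div_const, ← tsum_div_const]
  constructor
  · congr 1; ext n
    linear_combination (-(n 1 : ℝ) * b n * ee n z / 2) * Complex.I_sq
  · congr 1; ext n
    linear_combination ((n 1 : ℝ) * b n * ee n z / 2) * Complex.I_sq


abbrev TT := UnitAddTorus (Fin 2)

/-- the covering projection -/
noncomputable def prj (z : ℂ) : TT := fun j =>
  ((![z.re / (2 * Real.pi), z.im / (2 * Real.pi)] j : ℝ) : UnitAddCircle)

theorem prj_add (z w : ℂ) : prj (z + w) = prj z + prj w := by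
  funext j
  fin_cases j
  · simp only [prj, Pi.add_apply]
    rw [← AddCircle.coe_add]
    congr 1
    simp [add_div]
  · simp only [prj, Pi.add_apply]
    rw [← AddCircle.coe_add]
    congr 1
    simp [add_div]

theorem prj_quot : IsOpenQuotientMap prj := by
  have hpi : (2 * Real.pi) ≠ 0 := by positivity
  let h : ℂ ≃ₜ (Fin 2 → ℝ) :=
    { toFun := fun z => ![z.re / (2 * Real.pi), z.im / (2 * Real.pi)]
      invFun := fun v => ⟨v 0 * (2 * Real.pi), v 1 * (2 * Real.pi)⟩
      left_inv := by
        intro z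
        apply Complex.ext <;> simp [hpi]
      right_inv := by
        intro v
        funext j
        fin_cases j <;> simp [hpi]
      continuous_toFun := by
        refine continuous_pi fun j => ?_
        fin_cases j
        · exact Complex.continuous_re.div_const _
        · exact Complex.continuous_im.div_const _
      continuous_invFun := by
        have : (fun v : Fin 2 → ℝ => (⟨v 0 * (2 * Real.pi), v 1 * (2 * Real.pi)⟩ : ℂ)) =
            fun v => ((v 0 * (2 * Real.pi) : ℝ) : ℂ) + ((v 1 * (2 * Real.pi) : ℝ) : ℂ) * Complex.I := by
          funext v
          exact Complex.mk_eq_add_mul_I _ _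
        rw [this]
        fun_prop }
  have h1 : IsOpenQuotientMap (Pi.map (fun (_ : Fin 2) (x : ℝ) => (x : UnitAddCircle))) :=
    IsOpenQuotientMap.piMap (fun _ => QuotientAddGroup.isOpenQuotientMap_mk)
  exact h1.comp h.isOpenQuotientMap

theorem coe_eq_imp {x y : ℝ} (h : (x : UnitAddCircle) = y) : ∃ n : ℤ, x = y + n := by
  have : ((x - y : ℝ) : UnitAddCircle) = 0 := by
    rw [AddCircle.coe_sub, h, sub_self]
  rw [AddCircle.coe_eq_zero_iff] at this
  obtain ⟨n, hn⟩ := this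
  refine ⟨n, ?_⟩
  simp at hn
  linarith

theorem dp_factors {F : ℂ → ℂ} (pF : DP F) {z w : ℂ} (h : prj z = prj w) : F z = F w := by
  have hpi : (2 * Real.pi) ≠ 0 := by positivity
  obtain ⟨m, hm⟩ := coe_eq_imp (congrFun h 0)
  obtain ⟨k, hk⟩ := coe_eq_imp (congrFun h 1)
  simp at hm hk
  have h1 : z.re = w.re + m * (2 * Real.pi) := by field_simp at hm; linarith
  have h2 : z.im = w.im + k * (2 * Real.pi) := by field_simp at hk; linarith
  have e : z = (w + m * (2 * Real.pi)) + k * (2 * Real.pi * Complex.I) := by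
    apply Complex.ext <;> simp [h1, h2]
  have p1 : Function.Periodic F (2 * Real.pi) := fun z => (pF z).1
  have p2 : Function.Periodic F (2 * Real.pi * Complex.I) := fun z => (pF z).2
  rw [e, p2.int_mul k, p1.int_mul m]

open Classical in
/-- descent to the torus -/
noncomputable def lft (F : ℂ → ℂ) : C(TT, ℂ) :=
  if h : Continuous F ∧ DP F then
    Topology.IsQuotientMap.lift (f := ⟨prj, prj_quot.continuous⟩) prj_quot.isQuotientMap ⟨F, h.1⟩
      (fun _ _ hz => dp_factors h.2 hz)
  else 0

theorem lft_prj {F : ℂ → ℂ} (hF : Continuous F) (pF : DP F) (z : ℂ) : lft F (prj z) = F z := by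
  unfold lft
  rw [dif_pos ⟨hF, pF⟩]
  exact DFunLike.congr_fun (Topology.IsQuotientMap.lift_comp
    (f := ⟨prj, prj_quot.continuous⟩) prj_quot.isQuotientMap ⟨F, hF⟩
      (fun _ _ hz => dp_factors pF hz)) z

theorem TT_ext {f g : C(TT, ℂ)} (h : ∀ z, f (prj z) = g (prj z)) : f = g := by
  ext p
  obtain ⟨z, rfl⟩ := prj_quot.surjective p
  exact h z

theorem TT_norm_le {f : C(TT, ℂ)} {C : ℝ} (hC : 0 ≤ C) (h : ∀ z, ‖f (prj z)‖ ≤ C) : ‖f‖ ≤ C := by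
  rw [ContinuousMap.norm_le _ hC]
  intro p
  obtain ⟨z, rfl⟩ := prj_quot.surjective p
  exact h z

theorem dp_tr {F : ℂ → ℂ} (pF : DP F) (w : ℂ) : DP (fun z => F (z + w)) := by
  intro z
  have h := pF (z + w)
  rw [add_right_comm, add_right_comm z w] at h
  exact h

theorem lft_tr {F : ℂ → ℂ} (hF : Continuous F) (pF : DP F) (w : ℂ) (p : TT) :
    lft (fun z => F (z + w)) p = lft F (p + prj w) := by
  obtain ⟨z, rfl⟩ := prj_quot.surjective p
  rw [← prj_add, lft_prj hF pF, lft_prj (by fun_prop) (dp_tr pF w)]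

theorem line_deriv {F : ℂ → ℂ} (hF : ContDiff ℝ (⊤ : ℕ∞) F) (z v : ℂ) (t : ℝ) :
    HasDerivAt (fun t : ℝ => F (z + t * v)) (fderiv ℝ F (z + t * v) v) t := by
  have h1 : HasDerivAt (fun t : ℝ => z + t * v) v t := by
    have := ((Complex.ofRealCLM.hasDerivAt (x := t)).mul_const v).const_add z
    simpa using this
  exact ((hF.differentiable (by simp)) _).hasFDerivAt.comp_hasDerivAt t h1

theorem line_lip {F : ℂ → ℂ} (hF : ContDiff ℝ (⊤ : ℕ∞) F) (pF : DP F) (v : ℂ) :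
    ∃ C : ℝ, 0 ≤ C ∧ ∀ z : ℂ, ∀ s t : ℝ, ‖F (z + s * v) - F (z + t * v)‖ ≤ C * |s - t| := by
  obtain ⟨w, hw⟩ := dp_bdd (smooth_dir hF v).continuous (dp_dir pF v)
  refine ⟨‖fderiv ℝ F w v‖, norm_nonneg _, fun z s t => ?_⟩
  exact Convex.norm_image_sub_le_of_norm_hasDerivWithin_le (s := Set.univ) (𝕜 := ℝ)
    (fun x _ => (line_deriv hF z v x).hasDerivWithinAt) (fun x _ => hw _) convex_univ
    (Set.mem_univ t) (Set.mem_univ s)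

theorem line_taylor {F : ℂ → ℂ} (hF : ContDiff ℝ (⊤ : ℕ∞) F) (pF : DP F) (v : ℂ) :
    ∃ C : ℝ, 0 ≤ C ∧ ∀ z : ℂ, ∀ s t : ℝ,
      ‖F (z + s * v) - F (z + t * v) - (s - t : ℝ) * fderiv ℝ F (z + t * v) v‖ ≤ C * |s - t| ^ 2 := by
  obtain ⟨C, hC, hl⟩ := line_lip (smooth_dir hF v) (dp_dir pF v) v
  refine ⟨C, hC, fun z s t => ?_⟩
  have hd : ∀ x ∈ Set.uIcc t s, HasDerivWithinAt
      (fun x : ℝ => F (z + x * v) - (x : ℂ) * fderiv ℝ F (z + t * v) v)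
      (fderiv ℝ F (z + x * v) v - fderiv ℝ F (z + t * v) v) (Set.uIcc t s) x := by
    intro x _
    have h2 := (Complex.ofRealCLM.hasDerivAt (x := x)).mul_const (fderiv ℝ F (z + t * v) v)
    have := (line_deriv hF z v x).sub h2
    simp only [Complex.ofRealCLM_apply, Complex.ofReal_one, one_mul] at this
    exact this.hasDerivWithinAt
  have h := Convex.norm_image_sub_le_of_norm_hasDerivWithin_le (𝕜 := ℝ) (C := C * |s - t|) hd
    (fun x hx => (hl z x t).trans 
      (mul_le_mul_of_nonneg_left (Set.abs_sub_left_of_mem_uIcc hx) hC))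
    (convex_uIcc t s) Set.left_mem_uIcc Set.right_mem_uIcc
  rw [Real.norm_eq_abs, mul_assoc, ← sq] at h
  refine le_trans (le_of_eq ?_) h
  congr 1
  push_cast
  ring

theorem cont_tr {F : ℂ → ℂ} (hF : ContDiff ℝ (⊤ : ℕ∞) F) (w : ℂ) :
    Continuous (fun z => F (z + w)) := by
  have := hF.continuous
  fun_prop

theorem tr_deriv {F : ℂ → ℂ} (hF : ContDiff ℝ (⊤ : ℕ∞) F) (pF : DP F) (v : ℂ) (t : ℝ) :
    HasDerivAt (fun t : ℝ => lft (fun z => F (z + t * v)))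
      (lft (fun z => fderiv ℝ F (z + t * v) v)) t := by
  obtain ⟨C, hC, hT⟩ := line_taylor hF pF v
  rw [hasDerivAt_iff_isLittleO]
  have hO : (fun s : ℝ => lft (fun z => F (z + s * v)) - lft (fun z => F (z + t * v)) -
      (s - t) • lft (fun z => fderiv ℝ F (z + t * v) v)) =O[nhds t] fun s => (s - t) ^ 2 := by
    refine Asymptotics.IsBigO.of_bound C (Filter.Eventually.of_forall fun s => ?_)
    refine TT_norm_le (by positivity) fun z => ?_
    simp only [ContinuousMap.sub_apply, ContinuousMap.smul_apply]
    rw [lft_prj (cont_tr hF _) (dp_tr pF _), lft_prj (cont_tr hF _) (dp_tr pF _),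
      lft_prj (cont_tr (smooth_dir hF v) _) (dp_tr (dp_dir pF v) _)]
    have := hT z s t
    rw [Real.norm_eq_abs, abs_pow]
    rwa [Complex.real_smul]
  refine hO.trans_isLittleO ?_
  have h2 : (fun s : ℝ => (s - t) ^ 2) =o[nhds t] fun s => (s - t) ^ 1 := by
    have h3 := (Asymptotics.isLittleO_pow_pow (𝕜 := ℝ) (m := 1) (n := 2) (by norm_num))
    have h4 : Filter.Tendsto (fun s : ℝ => s - t) (nhds t) (nhds 0) := by
      have : Continuous (fun s : ℝ => s - t) := by fun_prop
      simpa using this.tendsto t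
    exact h3.comp_tendsto h4
  simpa using h2

theorem tr_smooth {F : ℂ → ℂ} (hF : ContDiff ℝ (⊤ : ℕ∞) F) (pF : DP F) (v : ℂ) :
    ContDiff ℝ (⊤ : ℕ∞) (fun t : ℝ => lft (fun z => F (z + t * v))) := by
  rw [contDiff_infty]
  intro k
  induction k generalizing F with
  | zero =>
    simp only [Nat.cast_zero, contDiff_zero]
    exact continuous_iff_continuousAt.2 fun z => (tr_deriv hF pF v z).continuousAt
  | succ k ih =>
    push_cast
    rw [contDiff_succ_iff_deriv]
    refine ⟨fun z => (tr_deriv hF pF v z).differentiableAt, by simp, ?_⟩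
    rw [show deriv (fun t : ℝ => lft (fun z => F (z + t * v))) = _ from
      funext fun z => (tr_deriv hF pF v z).deriv]
    exact ih (smooth_dir hF v) (dp_dir pF v)


attribute [local instance] instMeasureSpaceUnitAddCircle
local instance aux_haar : Measure.IsAddHaarMeasure (volume : Measure UnitAddCircle) :=
  inferInstanceAs (Measure.IsAddHaarMeasure AddCircle.haarAddCircle)
local instance aux_prob : IsProbabilityMeasure (volume : Measure UnitAddCircle) :=
  inferInstanceAs (IsProbabilityMeasure AddCircle.haarAddCircle)

noncomputable abbrev HH := Lp ℂ 2 (volume : Measure TT)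
noncomputable abbrev toH : C(TT, ℂ) →L[ℂ] HH := ContinuousMap.toLp (E := ℂ) 2 volume ℂ
noncomputable abbrev BB : HilbertBasis (Fin 2 → ℤ) ℂ HH := UnitAddTorus.mFourierBasis

theorem BB_apply (n : Fin 2 → ℤ) : BB n = toH (UnitAddTorus.mFourier n) := by
  simp [BB]

theorem mF_prj (n : Fin 2 → ℤ) (z : ℂ) : UnitAddTorus.mFourier n (prj z) = ee n z := by
  have hpi : (Real.pi : ℂ) ≠ 0 := by exact_mod_cast Real.pi_ne_zero
  simp only [UnitAddTorus.mFourier, ContinuousMap.coe_mk, Fin.prod_univ_two, prj]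
  rw [fourier_coe_apply, fourier_coe_apply, ← Complex.exp_add]
  unfold ee
  congr 1
  simp
  field_simp

/-- Multiplication operators -/
noncomputable def MM : C(TT, ℂ) →L[ℂ] HH →L[ℂ] HH :=
  ((ContinuousLinearMap.mul ℂ ℂ).holderL (volume : Measure TT) ⊤ 2 2).comp
    (ContinuousMap.toLp (E := ℂ) ⊤ (volume : Measure TT) ℂ)

theorem MM_coe (f : C(TT, ℂ)) (h : HH) : MM f h =ᵐ[volume] fun x => f x * h x := by
  have h1 := ContinuousMap.coeFn_toLp (E := ℂ) (p := ⊤) (𝕜 := ℂ) (volume : Measure TT) f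
  have h2 := (ContinuousLinearMap.mul ℂ ℂ).coeFn_holder (r := 2)
    (ContinuousMap.toLp (E := ℂ) ⊤ (volume : Measure TT) ℂ f) h
  filter_upwards [h1, h2] with x h1 h2
  change (((ContinuousLinearMap.mul ℂ ℂ).holder 2
    (ContinuousMap.toLp (E := ℂ) ⊤ (volume : Measure TT) ℂ f) h : HH) : TT → ℂ) x = _
  rw [h2, h1]; rfl

theorem MM_norm (f : C(TT, ℂ)) : ‖MM f‖ ≤ ‖f‖ := by
  refine ContinuousLinearMap.opNorm_le_bound _ (norm_nonneg _) fun h => ?_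
  refine (ContinuousLinearMap.norm_holder_apply_apply_le (r := 2) (ContinuousLinearMap.mul ℂ ℂ)
    (ContinuousMap.toLp (E := ℂ) ⊤ (volume : Measure TT) ℂ f) h).trans ?_
  gcongr
  refine (mul_le_of_le_one_left (norm_nonneg _) (ContinuousLinearMap.opNorm_mul_le ℂ ℂ)).trans ?_
  refine (ContinuousLinearMap.le_opNorm _ _).trans ?_
  refine mul_le_of_le_one_left (norm_nonneg _) ?_
  refine (ContinuousMap.toLp_norm_le _).trans ?_
  simp

theorem MM_toH (f g : C(TT, ℂ)) : MM f (toH g) = toH (f * g) := by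
  apply Lp.ext
  filter_upwards [MM_coe f (toH g), ContinuousMap.coeFn_toLp (p := 2) (𝕜 := ℂ) (volume : Measure TT) g,
    ContinuousMap.coeFn_toLp (p := 2) (𝕜 := ℂ) (volume : Measure TT) (f * g)] with x h1 h2 h3
  rw [h1, h2, h3]; rfl

/-- translation operators -/
theorem mp_tr (p : TT) : MeasurePreserving (fun x : TT => x + p) volume volume :=
  measurePreserving_add_right volume p

noncomputable def SS (w : ℂ) : HH →ₗᵢ[ℂ] HH :=
  Lp.compMeasurePreservingₗᵢ ℂ (fun x : TT => x + prj w) (mp_tr (prj w))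

theorem SS_coe (w : ℂ) (h : HH) : SS w h =ᵐ[volume] fun x => h (x + prj w) :=
  Lp.coeFn_compMeasurePreserving h (mp_tr (prj w))

theorem SS_toH (w : ℂ) (f g : C(TT, ℂ)) (hfg : ∀ x, g x = f (x + prj w)) : SS w (toH f) = toH g := by
  apply Lp.ext
  have h2 := (mp_tr (prj w)).quasiMeasurePreserving.ae
    (ContinuousMap.coeFn_toLp (p := 2) (𝕜 := ℂ) (volume : Measure TT) f)
  filter_upwards [SS_coe w (toH f), h2,
    ContinuousMap.coeFn_toLp (p := 2) (𝕜 := ℂ) (volume : Measure TT) g] with x h1 h2 h3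
  rw [h1, h2, h3, hfg]

theorem SS_MM (w : ℂ) (f g : C(TT, ℂ)) (hfg : ∀ x, g x = f (x + prj w)) (h : HH) :
    SS w (MM f h) = MM g (SS w h) := by
  apply Lp.ext
  have h2 := (mp_tr (prj w)).quasiMeasurePreserving.ae (MM_coe f h)
  filter_upwards [SS_coe w (MM f h), h2, MM_coe g (SS w h), SS_coe w h] with x h1 h2 h3 h4
  rw [h1, h2, h3, hfg, h4]

theorem mF_tr (n : Fin 2 → ℤ) (x : TT) (w : ℂ) :
    UnitAddTorus.mFourier n (x + prj w) = ee n w * UnitAddTorus.mFourier n x := by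
  obtain ⟨z, rfl⟩ := prj_quot.surjective x
  rw [← prj_add, mF_prj, mF_prj]
  unfold ee
  rw [← Complex.exp_add]
  congr 1
  simp
  ring

theorem SS_BB (w : ℂ) (n : Fin 2 → ℤ) : SS w (BB n) = ee n w • BB n := by
  rw [BB_apply, ← map_smul]
  exact SS_toH w _ _ (fun x => by rw [mF_tr]; rfl)

theorem SS_cf (w : ℂ) (n : Fin 2 → ℤ) (h : HH) :
    BB.repr (SS w h) n = ee n w * BB.repr h n := by
  rw [HilbertBasis.repr_apply_apply, HilbertBasis.repr_apply_apply,
    ← (SS w).inner_map_map (BB n) h, SS_BB, inner_smul_left, ← mul_assoc, Complex.mul_conj,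
    Complex.normSq_eq_norm_sq, ee_norm]
  simp

/-- diagonal operators -/
theorem exists_diag (d : (Fin 2 → ℤ) → ℂ) (hd : ∀ n, ‖d n‖ ≤ 1) :
    ∃ U : HH →L[ℂ] HH, ‖U‖ ≤ 1 ∧ ∀ h n, BB.repr (U h) n = d n * BB.repr h n := by
  have hle : ∀ (f : lp (fun _ : Fin 2 → ℤ => ℂ) 2) n, ‖d n * f n‖ ≤ ‖f n‖ := fun f n => by
    rw [norm_mul]; exact mul_le_of_le_one_left (norm_nonneg _) (hd n)
  let D0 : lp (fun _ : Fin 2 → ℤ => ℂ) 2 →ₗ[ℂ] lp (fun _ : Fin 2 → ℤ => ℂ) 2 :=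
    { toFun := fun f => ⟨fun n => d n * f n, (lp.memℓp f).mono' (hle f)⟩
      map_add' := fun f g => by
        ext n
        exact mul_add _ _ _
      map_smul' := fun c f => by
        ext n
        exact mul_left_comm _ _ _ }
  have hD0 : ∀ f, ‖D0 f‖ ≤ 1 * ‖f‖ := fun f => by
    rw [one_mul]
    exact lp.norm_mono (by norm_num) (hle f)
  have hD : ‖D0.mkContinuous 1 hD0‖ ≤ 1 := LinearMap.mkContinuous_norm_le _ zero_le_one _
  let R : HH →L[ℂ] lp (fun _ : Fin 2 → ℤ => ℂ) 2 := BB.repr.toContinuousLinearEquiv.toContinuousLinearMap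
  let R' : lp (fun _ : Fin 2 → ℤ => ℂ) 2 →L[ℂ] HH :=
    BB.repr.symm.toContinuousLinearEquiv.toContinuousLinearMap
  refine ⟨R'.comp ((D0.mkContinuous 1 hD0).comp R), ?_, ?_⟩
  · refine ContinuousLinearMap.opNorm_le_bound _ zero_le_one fun h => ?_
    change ‖BB.repr.symm (D0 (BB.repr h))‖ ≤ _
    rw [LinearIsometryEquiv.norm_map]
    refine (hD0 _).trans ?_
    rw [LinearIsometryEquiv.norm_map]
  · intro h n
    change BB.repr (BB.repr.symm (D0 (BB.repr h))) n = _
    rw [LinearIsometryEquiv.apply_symm_apply]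
    rfl

theorem repr_inj {h k : HH} (H : ∀ n, BB.repr h n = BB.repr k n) : h = k := by
  apply BB.repr.injective
  ext n
  exact H n

/-- decay -/
theorem cf_le (h : HH) (n : Fin 2 → ℤ) : ‖BB.repr h n‖ ≤ ‖h‖ := by
  rw [HilbertBasis.repr_apply_apply]
  refine (norm_inner_le_norm _ _).trans ?_
  rw [BB.orthonormal.1 n, one_mul]

theorem decay (j : Fin 2) (k : ℕ) (Ψ : ℝ → HH) (hΨ : ContDiff ℝ (⊤ : ℕ∞) Ψ)
    (b : (Fin 2 → ℤ) → ℂ)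
    (hb : ∀ t n, BB.repr (Ψ t) n = Complex.exp (Complex.I * (n j : ℝ) * (t : ℂ)) * b n) :
    ∃ C : ℝ, ∀ n, |(n j : ℝ)| ^ k * ‖b n‖ ≤ C := by
  induction k generalizing Ψ b with
  | zero =>
    refine ⟨‖Ψ 0‖, fun n => ?_⟩
    have := cf_le (Ψ 0) n
    rw [hb] at this
    simpa using this
  | succ k ih =>
    have hd : Differentiable ℝ Ψ := hΨ.differentiable (by simp)
    obtain ⟨C, hC⟩ := ih (deriv Ψ) (contDiff_infty_iff_deriv.1 hΨ).2
      (fun n => Complex.I * (n j : ℝ) * b n) (by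
        intro t n
        have h1 : HasDerivAt (fun t => BB.repr (Ψ t) n) (BB.repr (deriv Ψ t) n) t := by
          have h2 := ((innerSL ℂ (BB n)).restrictScalars ℝ).hasFDerivAt.comp_hasDerivAt t
            (hd t).hasDerivAt
          simp only [HilbertBasis.repr_apply_apply]
          exact h2
        have h3 : HasDerivAt (fun t : ℝ => Complex.exp (Complex.I * (n j : ℝ) * (t : ℂ)) * b n)
            (Complex.exp (Complex.I * (n j : ℝ) * (t : ℂ)) * (Complex.I * (n j : ℝ)) * b n) t := by
          have h4 := (Complex.ofRealCLM.hasDerivAt (x := t)).const_mul (Complex.I * (n j : ℝ))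
          simp only [Complex.ofRealCLM_apply, Complex.ofReal_one, mul_one] at h4
          exact (h4.cexp).mul_const (b n)
        simp only [hb] at h1
        rw [h1.unique h3]
        ring)
    refine ⟨C, fun n => ?_⟩
    have := hC n
    rw [norm_mul, norm_mul, Complex.norm_I, Complex.norm_real, Real.norm_eq_abs] at this
    rw [pow_succ]
    linarith

/-- elements with rapidly decaying coefficients are continuous functions -/
theorem synth (h : HH) (hr : RD (fun n => BB.repr h n)) :
    ∃ f : C(TT, ℂ), toH f = h ∧ ∀ z, f (prj z) = syn (fun n => BB.repr h n) z := by
  have hs : Summable (fun n => BB.repr h n • UnitAddTorus.mFourier n) := by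
    refine Summable.of_norm ?_
    simpa [norm_smul, UnitAddTorus.mFourier_norm] using hr.summable
  refine ⟨∑' n, BB.repr h n • UnitAddTorus.mFourier n, ?_, ?_⟩
  · have h1 := hs.hasSum.mapL toH
    have h2 := BB.hasSum_repr h
    refine h1.unique ?_
    convert h2 using 2 with n
    rw [map_smul, BB_apply]
  · intro z
    have h1 := hs.hasSum.mapL (ContinuousMap.evalCLM ℂ (prj z))
    have h2 := h1.tsum_eq
    simp only [ContinuousMap.evalCLM_apply, ContinuousMap.smul_apply, mF_prj, smul_eq_mul] at h2
    exact h2.symm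


theorem resolvent_smooth (U : HH →L[ℂ] HH) (hU : ‖U‖ ≤ 1) (k : ℝ) (hk : k < 1)
    (m q : ℝ → C(TT, ℂ)) (hm : ContDiff ℝ (⊤ : ℕ∞) m) (hq : ContDiff ℝ (⊤ : ℕ∞) q)
    (hmk : ∀ t, ‖m t‖ ≤ k) (Ψ : ℝ → HH)
    (hΨ : ∀ t, Ψ t = toH (q t) + MM (m t) (U (Ψ t))) : ContDiff ℝ (⊤ : ℕ∞) Ψ := by
  let L : C(TT, ℂ) →L[ℂ] HH →L[ℂ] HH := ((ContinuousLinearMap.compL ℂ HH HH HH).flip U).comp MM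
  have hL : ∀ f, L f = (MM f).comp U := fun f => rfl
  have hLn : ∀ t, ‖L (m t)‖ < 1 := fun t => by
    rw [hL]
    refine lt_of_le_of_lt ?_ hk
    refine (ContinuousLinearMap.opNorm_comp_le _ _).trans ?_
    refine (mul_le_of_le_one_right (norm_nonneg _) hU).trans ((MM_norm _).trans (hmk t))
  have sL : ContDiff ℝ (⊤ : ℕ∞) (fun t => L (m t)) :=
    (L.restrictScalars ℝ).contDiff.comp hm
  have s1 : ContDiff ℝ (⊤ : ℕ∞) (fun t => (1 : HH →L[ℂ] HH) - L (m t)) := contDiff_const.sub sL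
  have s2 : ContDiff ℝ (⊤ : ℕ∞) (fun t => Ring.inverse ((1 : HH →L[ℂ] HH) - L (m t))) := by
    rw [contDiff_iff_contDiffAt]
    intro t
    have h1 := (contDiffAt_ringInverse ℂ (n := ((⊤ : ℕ∞) : WithTop ℕ∞))
      (Units.oneSub (L (m t)) (hLn t))).restrict_scalars ℝ
    exact h1.comp t s1.contDiffAt
  have s3 : ContDiff ℝ (⊤ : ℕ∞) (fun t => toH (q t)) := (toH.restrictScalars ℝ).contDiff.comp hq
  have s4 := ((isBoundedBilinearMap_apply (𝕜 := ℂ) (E := HH) (F := HH)).contDiff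
    (n := ((⊤ : ℕ∞) : WithTop ℕ∞))).restrict_scalars ℝ
  have s5 := s4.comp (s2.prodMk s3)
  convert s5 using 1
  funext t
  have h1 : ((1 : HH →L[ℂ] HH) - L (m t)) (Ψ t) = toH (q t) := by
    have := hΨ t
    change Ψ t - MM (m t) (U (Ψ t)) = _
    rw [sub_eq_iff_eq_add]
    exact this
  change Ψ t = Ring.inverse ((1 : HH →L[ℂ] HH) - L (m t)) (toH (q t))
  rw [← h1]
  have h2 := Ring.inverse_mul_cancel ((1 : HH →L[ℂ] HH) - L (m t))
    (Units.oneSub (L (m t)) (hLn t)).isUnit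
  exact (DFunLike.congr_fun h2 (Ψ t)).symm

theorem resolvent_exists (U : HH →L[ℂ] HH) (hU : ‖U‖ ≤ 1) (m q : C(TT, ℂ)) (hm : ‖m‖ < 1) :
    ∃ ψ : HH, ψ = toH q + MM m (U ψ) := by
  have hn : ‖(MM m).comp U‖ < 1 := by
    refine lt_of_le_of_lt ?_ hm
    refine (ContinuousLinearMap.opNorm_comp_le _ _).trans ?_
    exact (mul_le_of_le_one_right (norm_nonneg _) hU).trans (MM_norm _)
  refine ⟨Ring.inverse ((1 : HH →L[ℂ] HH) - (MM m).comp U) (toH q), ?_⟩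
  have h2 := Ring.mul_inverse_cancel ((1 : HH →L[ℂ] HH) - (MM m).comp U)
    (Units.oneSub ((MM m).comp U) hn).isUnit
  have h3 := DFunLike.congr_fun h2 (toH q)
  rw [← sub_eq_iff_eq_add]
  exact h3

theorem lam_norm (n : Fin 2 → ℤ) : ‖Complex.I * ((n 0 : ℝ) : ℂ) + ((n 1 : ℝ) : ℂ)‖
    = ‖Complex.I * ((n 0 : ℝ) : ℂ) - ((n 1 : ℝ) : ℂ)‖ := by
  have : Complex.I * ((n 0 : ℝ) : ℂ) - ((n 1 : ℝ) : ℂ) =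
      -(starRingEnd ℂ (Complex.I * ((n 0 : ℝ) : ℂ) + ((n 1 : ℝ) : ℂ))) := by
    simp
    ring
  rw [this, norm_neg, RCLike.norm_conj]

theorem lam_ge (n : Fin 2 → ℤ) (hn : n ≠ 0) :
    1 ≤ ‖Complex.I * ((n 0 : ℝ) : ℂ) - ((n 1 : ℝ) : ℂ)‖ := by
  have h1 := Complex.abs_re_le_norm (Complex.I * ((n 0 : ℝ) : ℂ) - ((n 1 : ℝ) : ℂ))
  have h2 := Complex.abs_im_le_norm (Complex.I * ((n 0 : ℝ) : ℂ) - ((n 1 : ℝ) : ℂ))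
  simp at h1 h2
  have : n 0 ≠ 0 ∨ n 1 ≠ 0 := by
    by_contra hc
    push Not at hc
    apply hn
    funext j
    fin_cases j
    · exact hc.1
    · exact hc.2
  rcases this with h | h
  · have h3 : (1 : ℝ) ≤ |(n 0 : ℝ)| := by exact_mod_cast Int.one_le_abs h
    simpa using h3.trans h2
  · have h3 : (1 : ℝ) ≤ |(n 1 : ℝ)| := by exact_mod_cast Int.one_le_abs h
    simpa using h3.trans h1

theorem key_solve (μ : ℂ → ℂ) (hμ : ContDiff ℝ (⊤ : ℕ∞) μ) (pμ : DP μ) (hb : ∀ z, ‖μ z‖ < 1)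
    (g : ℂ → ℂ) (hg : ContDiff ℝ (⊤ : ℕ∞) g) (pg : DP g) :
    ∃ φ : ℂ → ℂ, ∃ c : ℂ, ContDiff ℝ (⊤ : ℕ∞) φ ∧ DP φ ∧
      ∀ z, wderivBar φ z - μ z * wderiv φ z = g z - c := by
  obtain ⟨z0, hz0⟩ := dp_bdd hμ.continuous pμ
  have hk := hb z0
  let lam : (Fin 2 → ℤ) → ℂ := fun n => (Complex.I * ((n 0 : ℝ) : ℂ) + ((n 1 : ℝ) : ℂ)) / 2
  let lamb : (Fin 2 → ℤ) → ℂ := fun n => (Complex.I * ((n 0 : ℝ) : ℂ) - ((n 1 : ℝ) : ℂ)) / 2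
  have hl : ∀ n, ‖lam n‖ = ‖lamb n‖ := fun n => by
    simp only [lam, lamb, norm_div, lam_norm]
  have hl2 : ∀ n, n ≠ 0 → 1 / 2 ≤ ‖lamb n‖ := fun n hn => by
    have := lam_ge n hn
    simp only [lamb, norm_div, Complex.norm_ofNat]
    linarith
  obtain ⟨U, hU, hUc⟩ := exists_diag (fun n => lam n / lamb n) (fun n => by
    rw [norm_div, hl]; exact div_self_le_one _)
  have htr : ∀ w, ‖lft (fun z => μ (z + w))‖ ≤ ‖μ z0‖ := fun w =>
    TT_norm_le (norm_nonneg _) fun z => by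
      rw [lft_prj (cont_tr hμ w) (dp_tr pμ w)]; exact hz0 _
  have hμ0 : ‖lft μ‖ ≤ ‖μ z0‖ := by simpa using htr 0
  obtain ⟨ψ, hψ⟩ := resolvent_exists U hU (lft μ) (lft g) (hμ0.trans_lt hk)
  have hSU : ∀ w h, SS w (U h) = U (SS w h) := fun w h => repr_inj fun n => by
    rw [SS_cf, hUc, hUc, SS_cf]; ring
  have hSψ : ∀ w, SS w ψ = toH (lft (fun z => g (z + w))) +
      MM (lft (fun z => μ (z + w))) (U (SS w ψ)) := by
    intro w
    conv_lhs => rw [hψ]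
    rw [map_add, SS_toH w _ _ (lft_tr hg.continuous pg w),
      SS_MM w _ _ (lft_tr hμ.continuous pμ w), hSU]
  have sm : ∀ v : ℂ, ContDiff ℝ (⊤ : ℕ∞) (fun t : ℝ => SS (t * v) ψ) := fun v =>
    resolvent_smooth U hU _ hk (fun t => lft (fun z => μ (z + t * v)))
      (fun t => lft (fun z => g (z + t * v))) (tr_smooth hμ pμ v) (tr_smooth hg pg v)
      (fun t => htr _) _ (fun t => hSψ _)
  let b : (Fin 2 → ℤ) → ℂ := fun n => BB.repr ψ n
  have rb : RD b := by
    refine RD_of_bounds fun j k => ?_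
    fin_cases j
    · refine decay 0 k _ (sm 1) b fun t n => ?_
      rw [SS_cf]
      simp only [ee, b]
      congr 2
      simp
      ring
    · refine decay 1 k _ (sm Complex.I) b fun t n => ?_
      rw [SS_cf]
      simp only [ee, b]
      congr 2
      simp
      ring
  have rc : RD (fun n => (lamb n)⁻¹ * b n) := by
    refine rb.mul (C := 2) (m := 0) fun n => ?_
    by_cases hn : n = 0
    · subst hn
      simp [lamb]
    · rw [norm_inv, pow_zero, mul_one]
      refine inv_le_of_inv_le₀ (by norm_num) ?_
      have := hl2 n hn
      linarith
  have rU : RD (fun n => BB.repr (U ψ) n) := by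
    simp only [hUc]
    refine rb.mul (C := 1) (m := 0) fun n => ?_
    rw [norm_div, hl, pow_zero, mul_one]; exact div_self_le_one _
  have rl : RD (fun n => lamb n * ((lamb n)⁻¹ * b n)) := by
    have : RD (fun n => (lamb n * (lamb n)⁻¹) * b n) := by
      refine rb.mul (C := 1) (m := 0) fun n => ?_
      rw [norm_mul, norm_inv, pow_zero, mul_one]; exact mul_inv_le_one
    simpa only [mul_assoc] using this
  obtain ⟨f, hf, hf2⟩ := synth ψ rb
  obtain ⟨u, hu, hu2⟩ := synth (U ψ) rU
  have hfu : f = lft g + lft μ * u := by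
    apply ContinuousMap.toLp_injective (p := 2) (𝕜 := ℂ) (volume : Measure TT)
    change toH f = toH (lft g + lft μ * u)
    rw [map_add, ← MM_toH, hf, hu]
    exact hψ
  refine ⟨syn (fun n => (lamb n)⁻¹ * b n), b 0, syn_smooth rc, syn_per _, fun z => ?_⟩
  obtain ⟨w1, w2⟩ := syn_w rc z
  have e1 : wderiv (syn (fun n => (lamb n)⁻¹ * b n)) z = u (prj z) := by
    rw [w1, hu2]
    congr 1
    funext n
    rw [hUc]
    change lam n * ((lamb n)⁻¹ * b n) = lam n / lamb n * b n
    ring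
  have e2 : wderivBar (syn (fun n => (lamb n)⁻¹ * b n)) z = f (prj z) - b 0 := by
    rw [w2, hf2]
    change syn (fun n => lamb n * ((lamb n)⁻¹ * b n)) z = syn b z - b 0
    rw [eq_sub_iff_add_eq, ← eq_sub_iff_add_eq']
    unfold syn
    rw [← Summable.tsum_sub (rb.hs z) (rl.hs z)]
    rw [tsum_eq_single 0]
    · simp [lamb, ee]
    · intro n hn
      have : lamb n ≠ 0 := by
        intro h0
        have := hl2 n hn
        rw [h0, norm_zero] at this
        norm_num at this
      rw [mul_inv_cancel_left₀ this, sub_self]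
  have e3 := DFunLike.congr_fun hfu (prj z)
  simp only [ContinuousMap.add_apply, ContinuousMap.mul_apply] at e3
  rw [lft_prj hg.continuous pg, lft_prj hμ.continuous pμ] at e3
  rw [e1, e2, e3]
  ring

theorem normSq_aux {a b μ : ℂ} (hμ : ‖μ‖ < 1) (h : b = μ * a) :
    0 ≤ Complex.normSq a - Complex.normSq b ∧
    (Complex.normSq a - Complex.normSq b ≤ 0 → a = 0) := by
  have h1 : Complex.normSq b = Complex.normSq μ * Complex.normSq a := by rw [h, map_mul]
  have h2 : Complex.normSq μ < 1 := by
    rw [Complex.normSq_eq_norm_sq]; nlinarith [norm_nonneg μ]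
  have h3 := Complex.normSq_nonneg a
  rw [h1]
  refine ⟨by nlinarith, fun h4 => ?_⟩
  rw [← Complex.normSq_eq_zero]
  nlinarith

theorem lin_inj {a v : ℂ} {b : ℂ} (h : ‖b‖ < ‖a‖) (hv : a * v + b * (starRingEnd ℂ v) = 0) :
    v = 0 := by
  have h1 : ‖a‖ * ‖v‖ = ‖b‖ * ‖v‖ := by
    have : a * v = -(b * (starRingEnd ℂ v)) := by linear_combination hv
    have := congrArg norm this
    rwa [norm_mul, norm_neg, norm_mul, RCLike.norm_conj] at this
  have h2 : ‖v‖ = 0 := by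
    by_contra h3
    have := mul_right_cancel₀ h3 h1
    linarith
  simpa using h2

theorem torus_uniformization
    (μ : ℂ → ℂ) (hμ : ContDiff ℝ (⊤ : ℕ∞) μ) (hper : DoublyPeriodic μ)
    (hbound : ∀ z : ℂ, ‖μ z‖ < 1) :
    ∃ ω₁ ω₂ : ℂ, LinearIndependent ℝ ![ω₁, ω₂] ∧
      ∃ Φ : ℂ → ℂ, ContDiff ℝ (⊤ : ℕ∞) Φ ∧ Function.Bijective Φ ∧
        ContDiff ℝ (⊤ : ℕ∞) (Function.invFun Φ) ∧
        (∀ z : ℂ, Φ (z + 2 * Real.pi) = Φ z + ω₁ ∧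
          Φ (z + 2 * Real.pi * Complex.I) = Φ z + ω₂) ∧
        ∀ z : ℂ, wderivBar Φ z = μ z * wderiv Φ z := by
  have pμ : DP μ := hper
  have hpi := Real.pi_pos
  have hc2 : starRingEnd ℂ (2 : ℂ) = 2 := map_ofNat (starRingEnd ℂ) 2
  have hpiC : (Real.pi : ℂ) ≠ 0 := by exact_mod_cast hpi.ne'
  obtain ⟨φ, a, sφ, pφ, eφ⟩ := key_solve μ hμ pμ hbound μ hμ pμ
  obtain ⟨ψ, c, sψ, pψ, eψ⟩ := key_solve μ hμ pμ hbound (wderiv μ) (smooth_w hμ).1 (dp_w pμ).1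
  have dμ : Differentiable ℝ μ := hμ.differentiable (by simp)
  have dφ : Differentiable ℝ φ := sφ.differentiable (by simp)
  have dψ : Differentiable ℝ ψ := sψ.differentiable (by simp)
  have dconj : Differentiable ℝ (fun w : ℂ => starRingEnd ℂ w) :=
    Complex.conjCLE.toContinuousLinearMap.differentiable
  have sconj : ContDiff ℝ (⊤ : ℕ∞) (fun w : ℂ => starRingEnd ℂ w) :=
    Complex.conjCLE.toContinuousLinearMap.contDiff
  let Φ : ℂ → ℂ := fun z => (z + a * starRingEnd ℂ z) + φ z
  have sΦ : ContDiff ℝ (⊤ : ℕ∞) Φ := (contDiff_id.add (contDiff_const.mul sconj)).add sφ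
  have dΦ : Differentiable ℝ Φ := sΦ.differentiable (by simp)
  have wlin : ∀ (b d z : ℂ), wderiv (fun z => b * z + d * starRingEnd ℂ z) z = b ∧
      wderivBar (fun z => b * z + d * starRingEnd ℂ z) z = d := by
    intro b d z
    have h1 := w_mul (differentiableAt_const b (𝕜 := ℝ) (x := z)) (differentiableAt_fun_id)
    have h2 := w_mul (differentiableAt_const d (𝕜 := ℝ) (x := z)) (dconj z)
    have h3 := w_add (z := z) (f := fun z => b * z) (g := fun z => d * starRingEnd ℂ z)
      (by fun_prop) ((differentiableAt_const d).mul (dconj z))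
    rw [h3.1, h3.2, h1.1, h1.2, h2.1, h2.2]
    simp [(w_const b z).1, (w_const b z).2, (w_const d z).1, (w_const d z).2, (w_id z).1,
      (w_id z).2, (w_conj z).1, (w_conj z).2]
  have dlin : ∀ (b d : ℂ), Differentiable ℝ (fun z : ℂ => b * z + d * starRingEnd ℂ z) :=
    fun b d => ((differentiable_const b).mul differentiable_id).add
      ((differentiable_const d).mul dconj)
  have wΦ : ∀ z, wderiv Φ z = 1 + wderiv φ z ∧ wderivBar Φ z = a + wderivBar φ z := by
    intro z
    have h1 := w_add (z := z) (dlin 1 a z) (dφ z)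
    have h2 := wlin 1 a z
    rw [h2.1, h2.2] at h1
    simpa [Φ] using h1
  have belt : ∀ z, wderivBar Φ z = μ z * wderiv Φ z := by
    intro z
    rw [(wΦ z).1, (wΦ z).2]
    linear_combination eφ z
  have per1 : ∀ z, Φ (z + 2 * Real.pi) = Φ z + 2 * Real.pi * (1 + a) := by
    intro z
    simp only [Φ, (pφ z).1]
    simp [hc2]
    ring
  have per2 : ∀ z, Φ (z + 2 * Real.pi * Complex.I) = Φ z + 2 * Real.pi * Complex.I * (1 - a) := by
    intro z
    simp only [Φ, (pφ z).2]
    simp [hc2]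
    ring
  -- `Φ` is not constant
  have nonconst : ¬ ∀ z, wderiv Φ z = 0 := by
    intro h
    have h2 : ∀ z, wderivBar Φ z = 0 := fun z => by rw [belt, h, mul_zero]
    have c1 := w_zero_const dΦ h h2 (0 + 2 * Real.pi) 0
    have c2 := w_zero_const dΦ h h2 (0 + 2 * Real.pi * Complex.I) 0
    rw [per1] at c1
    rw [per2] at c2
    have c1' : 2 * Real.pi * (1 + a) = 0 := by linear_combination c1
    have c2' : 2 * Real.pi * Complex.I * (1 - a) = 0 := by linear_combination c2
    have e1 : 1 + a = 0 := by simpa [hpiC] using c1'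
    have e2 : 1 - a = 0 := by simpa [hpiC] using c2'
    have : (2 : ℂ) = 0 := by linear_combination e1 + e2
    norm_num at this
  have ha : ‖a‖ < 1 := by
    by_contra hcon
    push Not at hcon
    have hN : 1 ≤ Complex.normSq a := by rw [Complex.normSq_eq_norm_sq]; nlinarith
    apply nonconst
    have pos := fun z => (normSq_aux (hbound z) (belt z)).1
    have hz := jac_zero φ sφ pφ (1 - a.re) (-a.im) (-a.im) (1 + a.re) 0 0
      (fun z => Complex.normSq (wderiv Φ z) - Complex.normSq (wderivBar Φ z)
        + (Complex.normSq a - 1))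
      (by
        intro z
        simp only [(wΦ z).1, (wΦ z).2]
        unfold wderiv wderivBar
        simp [Complex.normSq_apply]
        ring)
      (fun z => by have := pos z; linarith)
    intro z
    refine (normSq_aux (hbound z) (belt z)).2 ?_
    have := hz z
    linarith
  -- nonvanishing
  have nonvan : ∀ z, wderiv Φ z ≠ 0 := by
    obtain ⟨β, hβ⟩ : ∃ β : ℂ, c + β * a + starRingEnd ℂ β = 0 := by
      have hN : (1 : ℂ) - a * starRingEnd ℂ a ≠ 0 := by
        rw [Complex.mul_conj, Complex.normSq_eq_norm_sq]
        have : 1 - ‖a‖ ^ 2 ≠ 0 := by nlinarith [norm_nonneg a]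
        exact_mod_cast this
      have hN' : (1 : ℂ) - starRingEnd ℂ a * a ≠ 0 := by rwa [mul_comm (starRingEnd ℂ a)]
      refine ⟨(-(starRingEnd ℂ c) + starRingEnd ℂ a * c) / (1 - a * starRingEnd ℂ a), ?_⟩
      simp only [map_div₀, map_add, map_sub, map_neg, map_mul, map_one, Complex.conj_conj]
      field_simp
      ring
    set f := wderiv Φ with hf
    have sf : ContDiff ℝ (⊤ : ℕ∞) f := (smooth_w sΦ).1
    have df : Differentiable ℝ f := sf.differentiable (by simp)
    have pf : DP f := by
      intro z
      have := (dp_w pφ).1 z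
      simp only [(wΦ _).1, this.1, this.2, and_self]
    have ef : ∀ z, wderivBar f z = wderiv μ z * f z + μ z * wderiv f z := by
      intro z
      rw [hf, w_comm sΦ, show wderivBar Φ = fun w => μ w * f w from funext belt,
        (w_mul (dμ z) (df z)).1]
    let θ : ℂ → ℂ := fun z => -1 * ψ z + -β * φ z
    have sθ : ContDiff ℝ (⊤ : ℕ∞) θ := (contDiff_const.mul sψ).add (contDiff_const.mul sφ)
    have dθ : Differentiable ℝ θ := sθ.differentiable (by simp)
    have wθ : ∀ z, wderiv θ z = -wderiv ψ z - β * wderiv φ z ∧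
        wderivBar θ z = -wderivBar ψ z - β * wderivBar φ z := by
      intro z
      have h1 := w_mul (differentiableAt_const (-1 : ℂ) (𝕜 := ℝ) (x := z)) (dψ z)
      have h2 := w_mul (differentiableAt_const (-β) (𝕜 := ℝ) (x := z)) (dφ z)
      have h3 := w_add (z := z) (f := fun z => -1 * ψ z) (g := fun z => -β * φ z)
        ((differentiableAt_const _).mul (dψ z)) ((differentiableAt_const _).mul (dφ z))
      simp only [θ]
      rw [h3.1, h3.2, h1.1, h1.2, h2.1, h2.2, (w_const _ z).1, (w_const _ z).2, (w_const _ z).1,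
        (w_const _ z).2]
      constructor <;> ring
    let p : ℂ → ℂ := fun z => f z * Complex.exp (θ z)
    have sE : ContDiff ℝ (⊤ : ℕ∞) (fun z => Complex.exp (θ z)) := sθ.cexp
    have dE : Differentiable ℝ (fun z => Complex.exp (θ z)) := sE.differentiable (by simp)
    have sp : ContDiff ℝ (⊤ : ℕ∞) p := sf.mul sE
    have dp : Differentiable ℝ p := sp.differentiable (by simp)
    have pp : DP p := by
      intro z
      simp only [p, θ, (pf z).1, (pf z).2, (pψ z).1, (pψ z).2, (pφ z).1, (pφ z).2, and_self]
    have wp : ∀ z, wderiv p z = wderiv f z * Complex.exp (θ z)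
          + f z * (Complex.exp (θ z) * (-wderiv ψ z - β * wderiv φ z)) ∧
        wderivBar p z = wderivBar f z * Complex.exp (θ z)
          + f z * (Complex.exp (θ z) * (-wderivBar ψ z - β * wderivBar φ z)) := by
      intro z
      have h1 := w_mul (df z) (dE z)
      have h2 := w_exp (dθ z)
      simp only [p]
      rw [h1.1, h1.2, h2.1, h2.2, (wθ z).1, (wθ z).2]
      exact ⟨rfl, rfl⟩
    have ep : ∀ z, wderivBar p z + starRingEnd ℂ β * p z = μ z * (wderiv p z - β * p z) := by
      intro z
      rw [(wp z).1, (wp z).2, ef z]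
      simp only [p]
      have h1 := eφ z
      have h2 := eψ z
      linear_combination (f z * Complex.exp (θ z)) * hβ - (f z * Complex.exp (θ z)) * h2
        - (β * f z * Complex.exp (θ z)) * h1
    have hz := jac_zero p sp pp 0 0 0 0 (-β.re) β.im
      (fun z => Complex.normSq (wderiv p z - β * p z)
        - Complex.normSq (wderivBar p z + starRingEnd ℂ β * p z))
      (by
        intro z
        unfold wderiv wderivBar
        simp [Complex.normSq_apply]
        ring)
      (fun z => (normSq_aux (hbound z) (ep z)).1)
    have z1 : ∀ z, wderiv p z = β * p z := fun z =>
      sub_eq_zero.1 ((normSq_aux (hbound z) (ep z)).2 (hz z).le)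
    have z2 : ∀ z, wderivBar p z = -starRingEnd ℂ β * p z := fun z => by
      have := ep z
      rw [z1 z] at this
      linear_combination this
    let ℓ : ℂ → ℂ := fun z => (-β) * z + starRingEnd ℂ β * starRingEnd ℂ z
    have dℓ : Differentiable ℝ ℓ := dlin _ _
    have dEl : Differentiable ℝ (fun z => Complex.exp (ℓ z)) := dℓ.cexp
    have wg : ∀ z, wderiv (fun w => p w * Complex.exp (ℓ w)) z = 0 ∧
        wderivBar (fun w => p w * Complex.exp (ℓ w)) z = 0 := by
      intro z
      have h1 := w_mul (dp z) (dEl z)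
      have h2 := w_exp (dℓ z)
      have h3 := wlin (-β) (starRingEnd ℂ β) z
      rw [h1.1, h1.2, h2.1, h2.2, h3.1, h3.2, z1, z2]
      constructor <;> ring
    intro z0 hz0
    apply nonconst
    intro z
    have hc := w_zero_const (dp.mul dEl) (fun z => (wg z).1) (fun z => (wg z).2) z z0
    simp only [Pi.mul_apply, p, hz0, zero_mul] at hc
    simpa using hc
  -- derivative isomorphisms
  have hlt : ∀ z, ‖wderivBar Φ z‖ < ‖wderiv Φ z‖ := by
    intro z
    rw [belt, norm_mul]
    have := norm_pos_iff.2 (nonvan z)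
    nlinarith [hbound z]
  have hinj : ∀ z, Function.Injective (fderiv ℝ Φ z : ℂ →ₗ[ℝ] ℂ) := by
    intro z
    rw [injective_iff_map_eq_zero]
    intro v hv
    refine lin_inj (hlt z) ?_
    rw [← fderiv_eq_w]; exact hv
  let e : ℂ → (ℂ ≃L[ℝ] ℂ) := fun z =>
    (LinearEquiv.ofInjectiveEndo (fderiv ℝ Φ z : ℂ →ₗ[ℝ] ℂ) (hinj z)).toContinuousLinearEquiv
  have he : ∀ z, HasFDerivAt Φ (e z : ℂ →L[ℝ] ℂ) z := by
    intro z
    have : (e z : ℂ →L[ℝ] ℂ) = fderiv ℝ Φ z := by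
      apply ContinuousLinearMap.ext
      intro v; rfl
    rw [this]; exact (dΦ z).hasFDerivAt
  have hprop : Filter.Tendsto Φ (Filter.cocompact ℂ) (Filter.cocompact ℂ) := by
    obtain ⟨w, hw⟩ := dp_bdd sφ.continuous pφ
    rw [← Metric.cobounded_eq_cocompact, ← tendsto_norm_atTop_iff_cobounded]
    have h1 : Filter.Tendsto (fun z : ℂ => (1 - ‖a‖) * ‖z‖ - ‖φ w‖) (Bornology.cobounded ℂ)
        Filter.atTop :=
      Filter.tendsto_atTop_add_const_right _ _
        (Filter.Tendsto.const_mul_atTop (by linarith) tendsto_norm_cobounded_atTop)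
    refine Filter.tendsto_atTop_mono ?_ h1
    intro z
    have h2 : z = Φ z - a * starRingEnd ℂ z - φ z := by simp only [Φ]; ring
    have h3 : ‖z‖ ≤ ‖Φ z‖ + ‖a‖ * ‖z‖ + ‖φ z‖ := by
      conv_lhs => rw [h2]
      refine (norm_sub_le _ _).trans ?_
      gcongr
      refine (norm_sub_le _ _).trans ?_
      rw [norm_mul, RCLike.norm_conj]
    have := hw z
    linarith
  obtain ⟨hbij, hinv⟩ := proper_bijective Φ sΦ e he hprop
  refine ⟨2 * Real.pi * (1 + a), 2 * Real.pi * Complex.I * (1 - a), ?_, Φ, sΦ, hbij, hinv,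
    fun z => ⟨per1 z, per2 z⟩, belt⟩
  rw [LinearIndependent.pair_iff]
  intro s t hst
  have h0 : (1 : ℂ) * (2 * Real.pi * (s + t * Complex.I)) +
      a * starRingEnd ℂ (2 * Real.pi * (s + t * Complex.I)) = 0 := by
    simp only [Complex.real_smul] at hst
    simp [hc2]
    linear_combination hst
  have h1 := lin_inj (by simpa using ha) h0
  have h2 : (s : ℂ) + t * Complex.I = 0 := by simpa [hpiC] using h1
  have hr := congrArg Complex.re h2
  have hi := congrArg Complex.im h2
  simp at hr hi
  exact ⟨hr, hi⟩
end

section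
/- Let μ : ℂ → ℂ be a C^∞ doubly periodic function with |μ(z)| < 1 for all z. Then there exists a C^∞ doubly periodic function f : ℂ → ℂ with f(z) ≠ 0 for every z, satisfying the partial differential equation ∂f/∂z̄ = ∂(μ·f)/∂z on ℂ (i.e., the 1-form f·(dz + μ dz̄) is closed, so that it is a uniformizing differential for the almost complex structure defined by μ). -/
open MeasureTheory

namespace UD
open Complex

/-- smooth doubly periodic functions -/
noncomputable def TA : Subalgebra ℂ (ℂ → ℂ) where
  carrier := {f | ContDiff ℝ (⊤ : ℕ∞) f ∧ DoublyPeriodic f}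
  mul_mem' := by
    rintro f g ⟨hf, pf⟩ ⟨hg, pg⟩
    exact ⟨hf.mul hg, fun z => ⟨by simp [(pf z).1, (pg z).1], by simp [(pf z).2, (pg z).2]⟩⟩
  add_mem' := by
    rintro f g ⟨hf, pf⟩ ⟨hg, pg⟩
    exact ⟨hf.add hg, fun z => ⟨by simp [(pf z).1, (pg z).1], by simp [(pf z).2, (pg z).2]⟩⟩
  algebraMap_mem' := by
    intro r
    exact ⟨contDiff_const, fun z => ⟨rfl, rfl⟩⟩

lemma smooth (f : TA) : ContDiff ℝ (⊤ : ℕ∞) (f : ℂ → ℂ) := f.2.1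
lemma diffb (f : TA) : Differentiable ℝ (f : ℂ → ℂ) := (smooth f).differentiable (by simp)
lemma cont (f : TA) : Continuous (f : ℂ → ℂ) := (smooth f).continuous
lemma per1 (f : TA) (z : ℂ) : (f : ℂ → ℂ) (z + 2 * Real.pi) = (f : ℂ → ℂ) z := (f.2.2 z).1
lemma per2 (f : TA) (z : ℂ) : (f : ℂ → ℂ) (z + 2 * Real.pi * I) = (f : ℂ → ℂ) z := (f.2.2 z).2

lemma fd_per (f : TA) (v z : ℂ) :
    fderiv ℝ (f : ℂ → ℂ) (z + 2 * Real.pi) v = fderiv ℝ (f : ℂ → ℂ) z v ∧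
    fderiv ℝ (f : ℂ → ℂ) (z + 2 * Real.pi * I) v = fderiv ℝ (f : ℂ → ℂ) z v := by
  constructor
  · rw [← fderiv_comp_add_right]
    congr 2
    exact funext (fun z => per1 f z)
  · rw [← fderiv_comp_add_right]
    congr 2
    exact funext (fun z => per2 f z)

lemma fd_smooth (f : TA) (v : ℂ) : ContDiff ℝ (⊤ : ℕ∞) (fun z => fderiv ℝ (f : ℂ → ℂ) z v) :=
  ((smooth f).fderiv_right (m := (⊤ : ℕ∞)) (by simp)).clm_apply contDiff_const

/-- `∂` -/
noncomputable def d : Derivation ℂ TA TA := Derivation.mk'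
  { toFun := fun f => ⟨wderiv f, by
      constructor
      · exact ((fd_smooth f 1).sub (contDiff_const.mul (fd_smooth f I))).div_const 2
      · intro z
        simp only [wderiv, fd_per, and_self]⟩
    map_add' := by
      intro f g
      ext z
      simp only [wderiv, AddMemClass.coe_add, Pi.add_apply]
      rw [fderiv_add (diffb f z) (diffb g z)]
      simp only [_root_.add_apply]
      ring
    map_smul' := by
      intro c f
      ext z
      simp only [wderiv, SetLike.val_smul, Pi.smul_apply, RingHom.id_apply]
      rw [fderiv_const_smul (diffb f z)]
      simp only [_root_.smul_apply, smul_eq_mul]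
      ring }
  (by
    intro f g
    ext z
    simp only [wderiv, LinearMap.coe_mk, AddHom.coe_mk, MulMemClass.coe_mul, AddMemClass.coe_add,
      Pi.add_apply, smul_eq_mul, Pi.mul_apply]
    rw [fderiv_mul (diffb f z) (diffb g z)]
    simp only [_root_.add_apply, _root_.smul_apply, smul_eq_mul]
    ring)

/-- `∂bar` -/
noncomputable def b : Derivation ℂ TA TA := Derivation.mk'
  { toFun := fun f => ⟨wderivBar f, by
      constructor
      · exact ((fd_smooth f 1).add (contDiff_const.mul (fd_smooth f I))).div_const 2
      · intro z
        simp only [wderivBar, fd_per, and_self]⟩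
    map_add' := by
      intro f g
      ext z
      simp only [wderivBar, AddMemClass.coe_add, Pi.add_apply]
      rw [fderiv_add (diffb f z) (diffb g z)]
      simp only [_root_.add_apply]
      ring
    map_smul' := by
      intro c f
      ext z
      simp only [wderivBar, SetLike.val_smul, Pi.smul_apply, RingHom.id_apply]
      rw [fderiv_const_smul (diffb f z)]
      simp only [_root_.smul_apply, smul_eq_mul]
      ring }
  (by
    intro f g
    ext z
    simp only [wderivBar, LinearMap.coe_mk, AddHom.coe_mk, MulMemClass.coe_mul, AddMemClass.coe_add,
      Pi.add_apply, smul_eq_mul, Pi.mul_apply]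
    rw [fderiv_mul (diffb f z) (diffb g z)]
    simp only [_root_.add_apply, _root_.smul_apply, smul_eq_mul]
    ring)

lemma d_apply (f : TA) (z : ℂ) : (d f : ℂ → ℂ) z = wderiv f z := rfl
lemma b_apply (f : TA) (z : ℂ) : (b f : ℂ → ℂ) z = wderivBar f z := rfl

lemma fd_one (f : TA) (z : ℂ) : fderiv ℝ (f : ℂ → ℂ) z 1 = (d f : ℂ → ℂ) z + (b f : ℂ → ℂ) z := by
  rw [d_apply, b_apply, wderiv, wderivBar]; ring
lemma fd_I (f : TA) (z : ℂ) :
    fderiv ℝ (f : ℂ → ℂ) z I = I * ((d f : ℂ → ℂ) z - (b f : ℂ → ℂ) z) := by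
  rw [d_apply, b_apply, wderiv, wderivBar]
  linear_combination (fderiv ℝ (f : ℂ → ℂ) z I) * I_mul_I

lemma d_b (f : TA) : d (b f) = b (d f) := by
  ext z
  have key : ∀ v w : ℂ, fderiv ℝ (fun z => fderiv ℝ (f : ℂ → ℂ) z v) z w
      = fderiv ℝ (fderiv ℝ (f : ℂ → ℂ)) z w v := by
    intro v w
    have := ((smooth f).fderiv_right (m := (⊤ : ℕ∞)) (by simp)).differentiable (by simp) z
    rw [fderiv_clm_apply this (by fun_prop)]
    simp
  have sym : fderiv ℝ (fderiv ℝ (f : ℂ → ℂ)) z 1 I = fderiv ℝ (fderiv ℝ (f : ℂ → ℂ)) z I 1 := by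
    have h := ((smooth f).contDiffAt (x := z)).isSymmSndFDerivAt (by simp only [minSmoothness_of_isRCLikeNormedField]; exact WithTop.coe_le_coe.2 (le_top : (2:ℕ∞) ≤ ⊤))
    exact h.eq 1 I
  have db : ∀ v, DifferentiableAt ℝ (fun z => fderiv ℝ (f : ℂ → ℂ) z v) z := fun v =>
    (fd_smooth f v).differentiable (by simp) z
  have e1 : (b f : ℂ → ℂ) = fun z => (fderiv ℝ (f : ℂ → ℂ) z 1 + I * fderiv ℝ (f : ℂ → ℂ) z I) * 2⁻¹ := by
    ext z; rw [b_apply, wderivBar]; ring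
  have e2 : (d f : ℂ → ℂ) = fun z => (fderiv ℝ (f : ℂ → ℂ) z 1 - I * fderiv ℝ (f : ℂ → ℂ) z I) * 2⁻¹ := by
    ext z; rw [d_apply, wderiv]; ring
  rw [d_apply, b_apply, wderiv, wderivBar, e1, e2]
  rw [fderiv_mul_const (by fun_prop), fderiv_mul_const (by fun_prop)]
  rw [fderiv_fun_add (by fun_prop) (by fun_prop), fderiv_fun_sub (by fun_prop) (by fun_prop)]
  rw [fderiv_const_mul (by fun_prop)]
  simp only [_root_.smul_apply, _root_.add_apply, smul_eq_mul,
    _root_.sub_apply, key, sym]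
  ring

end UD

namespace UD
open PowerSeries

section alg
variable {A : Type*} [CommRing A] [Algebra ℂ A]

/-- coefficientwise derivation -/
noncomputable def hat (D : Derivation ℂ A A) (F : PowerSeries A) : PowerSeries A :=
  PowerSeries.mk fun n => D (coeff n F)

lemma coeff_hat (D : Derivation ℂ A A) (F : PowerSeries A) (n : ℕ) :
    coeff n (hat D F) = D (coeff n F) := by simp [hat]

lemma hat_mul (D : Derivation ℂ A A) (F G : PowerSeries A) :
    hat D (F * G) = F * hat D G + G * hat D F := by
  ext n
  rw [coeff_hat, mul_comm G, map_add, coeff_mul, coeff_mul, coeff_mul, map_sum,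
    ← Finset.sum_add_distrib]
  refine Finset.sum_congr rfl fun p _ => ?_
  rw [coeff_hat, coeff_hat, Derivation.leibniz]
  simp only [smul_eq_mul]
  ring

lemma hat_deriv (D : Derivation ℂ A A) (F : PowerSeries A) :
    hat D (derivative A F) = derivative A (hat D F) := by
  ext n
  rw [coeff_hat, coeff_derivative, coeff_derivative, coeff_hat, Derivation.leibniz]
  have : D ((n : A) + 1) = 0 := by
    have := D.map_natCast (n + 1)
    push_cast at this
    exact this
  rw [this]
  simp [mul_comm]

lemma ps_ext {F G : PowerSeries A} (h : derivative A F = derivative A G)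
    (h0 : coeff 0 F = coeff 0 G) : F = G := by
  ext n
  rcases n with _ | n
  · exact h0
  · have := congrArg (coeff n) h
    rw [coeff_derivative, coeff_derivative] at this
    have hu : IsUnit ((n : A) + 1) := by
      have : ((n : A) + 1) = algebraMap ℂ A ((n : ℂ) + 1) := by simp
      rw [this]
      exact (IsUnit.mk0 _ (Nat.cast_add_one_ne_zero n)).map _
    exact hu.mul_right_cancel this

lemma formal_log (d b : Derivation ℂ A A) (μ : A) (f : ℕ → A) (f0 : f 0 = 1)
    (hf : ∀ n, b (f (n + 1)) = d (μ * f n)) :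
    ∃ g : ℕ → A, b (g 1) = d μ ∧ ∀ n, b (g (n + 2)) = μ * d (g (n + 1)) := by
  set F : PowerSeries A := PowerSeries.mk f with hF
  have hu : IsUnit F := by
    rw [PowerSeries.isUnit_iff_constantCoeff]
    simp [hF, f0]
  obtain ⟨Fi, hFi⟩ := hu.exists_right_inv
  set U := derivative A F * Fi with hU
  set G : PowerSeries A := PowerSeries.mk fun n => ((n : ℂ)⁻¹) • coeff (n - 1) U with hG
  have hG' : derivative A G = U := by
    ext n
    rw [coeff_derivative, hG, coeff_mk]
    have : ((n : A) + 1) = algebraMap ℂ A ((n : ℂ) + 1) := by simp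
    rw [this, mul_comm, ← Algebra.smul_def, smul_smul]
    push_cast
    rw [mul_inv_cancel₀ (Nat.cast_add_one_ne_zero n)]
    simp
  have key : ∀ D : Derivation ℂ A A, hat D G = hat D F * Fi := by
    intro D
    apply ps_ext
    · rw [← hat_deriv, hG', hU, hat_mul, hat_deriv, Derivation.leibniz]
      simp only [smul_eq_mul]
      have h1 : derivative A F * Fi + F * derivative A Fi = 0 := by
        have := congrArg (derivative A) hFi
        rw [Derivation.leibniz] at this
        simp only [smul_eq_mul, Derivation.map_one_eq_zero] at this
        linear_combination this
      have h2 : hat D F * Fi + F * hat D Fi = 0 := by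
        have := congrArg (hat D) hFi
        rw [hat_mul] at this
        have h1 : hat D (1 : PowerSeries A) = 0 := by
          ext n
          rw [coeff_hat, coeff_one]
          split_ifs <;> simp
        rw [h1] at this
        linear_combination this
      linear_combination (derivative A F * Fi) * h2 - (hat D F * Fi) * h1 -
        (derivative A F * hat D Fi - hat D F * derivative A Fi) * hFi
    · simp only [coeff_mul, Finset.Nat.antidiagonal_zero, Finset.sum_singleton, coeff_hat]
      simp [hG, hF, f0]
  have hb : hat b F = X * (C (d μ) * F + C μ * hat d F) := by
    ext n
    rcases n with _ | n
    · simp [coeff_hat, hF, f0]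
    · rw [coeff_hat, mul_comm X, coeff_succ_mul_X, map_add, coeff_C_mul, coeff_C_mul, coeff_hat]
      simp only [hF, coeff_mk]
      rw [hf, Derivation.leibniz]
      simp only [smul_eq_mul]
      ring
  have hfin : hat b G = X * (C (d μ) + C μ * hat d G) := by
    rw [key, key, hb]
    linear_combination (X * C (d μ)) * hFi
  refine ⟨fun n => coeff n G, ?_, ?_⟩
  · have := congrArg (coeff 1) hfin
    rw [coeff_hat, mul_comm X, show (1:ℕ) = 0 + 1 from rfl, coeff_succ_mul_X, map_add, coeff_C_mul,
      coeff_hat] at this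
    simpa [hG] using this
  · intro n
    have := congrArg (coeff (n + 2)) hfin
    rw [coeff_hat, mul_comm X, coeff_succ_mul_X, map_add, coeff_C_mul,
      coeff_hat, coeff_C] at this
    simpa using this
end alg
end UD

namespace UD
open Complex intervalIntegral

section
variable {E : Type*} [NormedAddCommGroup E] [NormedSpace ℝ E]

/-- integral over the fundamental square -/
noncomputable def II (φ : ℂ → E) : E :=
  ∫ y in (0:ℝ)..2 * Real.pi, ∫ x in (0:ℝ)..2 * Real.pi, φ (x + y * I)

lemma tp : (0:ℝ) ≤ 2 * Real.pi := by positivity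

lemma c_in {φ : ℂ → E} (h : Continuous φ) (y : ℝ) : Continuous fun x : ℝ => φ (x + y * I) := by
  fun_prop
lemma c_out {φ : ℂ → E} (h : Continuous φ) :
    Continuous fun y : ℝ => ∫ x in (0:ℝ)..2 * Real.pi, φ (x + y * I) := by
  apply continuous_parametric_intervalIntegral_of_continuous'
  simp only [Function.uncurry_def]
  fun_prop

lemma II_add {φ ψ : ℂ → E} (h : Continuous φ) (k : Continuous ψ) :
    II (fun z => φ z + ψ z) = II φ + II ψ := by
  unfold II
  rw [← integral_add ((c_out h).intervalIntegrable _ _) ((c_out k).intervalIntegrable _ _)]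
  congr 1
  ext y
  rw [← integral_add ((c_in h y).intervalIntegrable _ _) ((c_in k y).intervalIntegrable _ _)]

lemma II_smul {𝕜 : Type*} [RCLike 𝕜] [NormedSpace 𝕜 E] [SMulCommClass ℝ 𝕜 E] (c : 𝕜) (φ : ℂ → E) :
    II (fun z => c • φ z) = c • II φ := by
  unfold II
  simp only [intervalIntegral.integral_smul]

lemma II_mono {φ ψ : ℂ → ℝ} (h : Continuous φ) (k : Continuous ψ) (hk : ∀ z, φ z ≤ ψ z) :
    II φ ≤ II ψ := by
  unfold II
  apply integral_mono tp ((c_out h).intervalIntegrable _ _) ((c_out k).intervalIntegrable _ _)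
  intro y
  exact integral_mono tp ((c_in h y).intervalIntegrable _ _) ((c_in k y).intervalIntegrable _ _)
    fun x => hk _

lemma II_norm {φ : ℂ → E} (h : Continuous φ) : ‖II φ‖ ≤ II (fun z => ‖φ z‖) := by
  unfold II
  refine (intervalIntegral.norm_integral_le_integral_norm tp).trans ?_
  have h' : Continuous fun z => ‖φ z‖ := h.norm
  apply integral_mono tp ((c_out h).norm.intervalIntegrable _ _) ((c_out h').intervalIntegrable _ _)
  intro y
  exact norm_integral_le_integral_norm tp

lemma II_const (c : ℝ) : II (fun _ => c) = (2 * Real.pi) ^ 2 * c := by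
  unfold II
  simp
  ring

lemma II_nonneg {φ : ℂ → ℝ} (h : Continuous φ) (hk : ∀ z, 0 ≤ φ z) : 0 ≤ II φ := by
  have := II_mono continuous_const h hk
  rwa [II_const, mul_zero] at this

lemma II_swap {φ : ℂ → E} (h : Continuous φ) :
    II φ = ∫ x in (0:ℝ)..2 * Real.pi, ∫ y in (0:ℝ)..2 * Real.pi, φ (x + y * I) := by
  unfold II
  rw [MeasureTheory.intervalIntegral_intervalIntegral_swap]
  have : Continuous (Function.uncurry fun (y x : ℝ) => φ (x + y * I)) := by
    simp only [Function.uncurry_def]; fun_prop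
  refine (this.continuousOn.integrableOn_compact
    ((isCompact_uIcc (a := (0:ℝ)) (b := 2 * Real.pi)).prod (isCompact_uIcc (a := (0:ℝ)) (b := 2 * Real.pi)))).mono_set ?_
  exact Set.prod_mono Set.uIoc_subset_uIcc Set.uIoc_subset_uIcc
end

lemma II_fd_one (f : TA) : II (fun z => fderiv ℝ (f : ℂ → ℂ) z 1) = 0 := by
  have hc : Continuous (fun z => fderiv ℝ (f : ℂ → ℂ) z 1) := (fd_smooth f 1).continuous
  unfold II
  have : ∀ y : ℝ, ∫ x in (0:ℝ)..2 * Real.pi, fderiv ℝ (f : ℂ → ℂ) (x + y * I) 1 = 0 := by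
    intro y
    rw [integral_eq_sub_of_hasDerivAt (f := fun x : ℝ => (f : ℂ → ℂ) (x + y * I))
      _ ((c_in hc y).intervalIntegrable _ _)]
    · have := per1 f (y * I)
      push_cast
      rw [add_comm, this]
      simp
    · intro x _
      have h1 : HasDerivAt (fun x : ℝ => (x : ℂ) + y * I) 1 x := by
        simpa using (hasDerivAt_id x).ofReal_comp.add_const (y * I)
      exact (diffb f _).hasFDerivAt.comp_hasDerivAt x h1
  simp [this]

lemma II_fd_I (f : TA) : II (fun z => fderiv ℝ (f : ℂ → ℂ) z I) = 0 := by
  have hc : Continuous (fun z => fderiv ℝ (f : ℂ → ℂ) z I) := (fd_smooth f I).continuous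
  rw [II_swap hc]
  have : ∀ x : ℝ, ∫ y in (0:ℝ)..2 * Real.pi, fderiv ℝ (f : ℂ → ℂ) (x + y * I) I = 0 := by
    intro x
    have hc' : Continuous fun y : ℝ => fderiv ℝ (f : ℂ → ℂ) (x + y * I) I :=
      hc.comp (by fun_prop : Continuous fun y : ℝ => (x : ℂ) + y * I)
    rw [integral_eq_sub_of_hasDerivAt (f := fun y : ℝ => (f : ℂ → ℂ) (x + y * I))
      _ (hc'.intervalIntegrable _ _)]
    · have := per2 f x
      push_cast
      rw [this]
      simp
    · intro y _
      have h1 : HasDerivAt (fun y : ℝ => (x : ℂ) + y * I) I y := by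
        simpa using ((hasDerivAt_id y).ofReal_comp.mul_const I).const_add (x : ℂ)
      exact (diffb f _).hasFDerivAt.comp_hasDerivAt y h1
  simp [this]

/-- the integral as a linear map -/
noncomputable def J : TA →ₗ[ℂ] ℂ where
  toFun f := II (f : ℂ → ℂ)
  map_add' f g := II_add (cont f) (cont g)
  map_smul' c f := II_smul c (f : ℂ → ℂ)

lemma J_db (f : TA) : J (d f) = 0 ∧ J (b f) = 0 := by
  have h1 : J (d f) + J (b f) = 0 := by
    rw [← map_add, ← II_fd_one f]
    change II _ = II _
    congr 1
    ext z
    rw [fd_one]; rfl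
  have h2 : J (d f) - J (b f) = 0 := by
    rw [← map_sub]
    have := II_fd_I f
    have h3 : II (fun z => fderiv ℝ (f : ℂ → ℂ) z I) = I * J (d f - b f) := by
      rw [← smul_eq_mul]
      change _ = I • II _
      rw [← II_smul]
      congr 1
      ext z
      rw [fd_I]; rfl
    rw [h3] at this
    simpa using this
  constructor
  · linear_combination (h1 + h2) / 2
  · linear_combination (h1 - h2) / 2

lemma J_d_parts (f g : TA) : J (d f * g) = - J (f * d g) := by
  have := (J_db (f * g)).1
  rw [Derivation.leibniz, map_add] at this
  simp only [smul_eq_mul] at this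
  rw [mul_comm (d f)]
  linear_combination this
lemma J_b_parts (f g : TA) : J (b f * g) = - J (f * b g) := by
  have := (J_db (f * g)).2
  rw [Derivation.leibniz, map_add] at this
  simp only [smul_eq_mul] at this
  rw [mul_comm (b f)]
  linear_combination this

/-- squared L2 norm -/
noncomputable def N (f : TA) : ℝ := II fun z => ‖(f : ℂ → ℂ) z‖ ^ 2

lemma N_nonneg (f : TA) : 0 ≤ N f :=
  II_nonneg ((cont f).norm.pow 2) fun z => by positivity

lemma J_le (f : TA) {ε : ℝ} (hε : 0 < ε) :
    ‖J f‖ ≤ (2 * Real.pi) ^ 2 * ε + ε⁻¹ * N f := by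
  refine (II_norm (cont f)).trans ?_
  have hc := (cont f).norm
  rw [← II_const, ← smul_eq_mul ε⁻¹, N, ← II_smul, ← II_add (by fun_prop) (by fun_prop)]
  apply II_mono (by fun_prop) (by fun_prop)
  intro z
  simp only [smul_eq_mul]
  have h : ε⁻¹ * ε = 1 := inv_mul_cancel₀ hε.ne'
  have : 0 < ε⁻¹ := by positivity
  have := mul_nonneg this.le (sq_nonneg (‖(f : ℂ → ℂ) z‖ - ε))
  have e : ε⁻¹ * (‖(f : ℂ → ℂ) z‖ - ε) ^ 2 = ε⁻¹ * ‖(f : ℂ → ℂ) z‖ ^ 2 - 2 * ‖(f : ℂ → ℂ) z‖ + ε := by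
    linear_combination (ε - 2 * ‖(f : ℂ → ℂ) z‖) * h
  have := norm_nonneg ((f : ℂ → ℂ) z)
  linarith

lemma N_comb (f g h : TA) (a c : ℝ)
    (H : ∀ z, ‖(f : ℂ → ℂ) z‖ ^ 2 ≤ a * ‖(g : ℂ → ℂ) z‖ ^ 2 + c * ‖(h : ℂ → ℂ) z‖ ^ 2) :
    N f ≤ a * N g + c * N h := by
  have h1 := (cont f).norm
  have h2 := (cont g).norm
  have h3 := (cont h).norm
  rw [← smul_eq_mul a, ← smul_eq_mul c, N, N, N, ← II_smul, ← II_smul,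
    ← II_add (by fun_prop) (by fun_prop)]
  exact II_mono (by fun_prop) (by fun_prop) H

/-- complex conjugation -/
noncomputable def cj (f : TA) : TA := ⟨fun z => (starRingEnd ℂ) ((f : ℂ → ℂ) z), by
  constructor
  · exact conjCLE.contDiff.comp (smooth f)
  · intro z
    simp only [per1, per2, and_self]⟩

lemma cj_fd (f : TA) (z v : ℂ) : fderiv ℝ (cj f : ℂ → ℂ) z v = (starRingEnd ℂ) (fderiv ℝ (f : ℂ → ℂ) z v) := by
  have : HasFDerivAt (cj f : ℂ → ℂ) ((conjCLE : ℂ →L[ℝ] ℂ).comp (fderiv ℝ (f : ℂ → ℂ) z)) z :=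
    conjCLE.hasFDerivAt.comp z (diffb f z).hasFDerivAt
  rw [this.fderiv]
  rfl

lemma d_cj (f : TA) : d (cj f) = cj (b f) := by
  ext z
  change _ = (starRingEnd ℂ) ((b f : ℂ → ℂ) z)
  rw [d_apply, b_apply, wderiv, wderivBar, cj_fd, cj_fd]
  have h2 : (starRingEnd ℂ) 2 = 2 := Complex.conj_eq_iff_real.2 ⟨2, by simp⟩
  simp [sub_eq_add_neg, h2]
lemma b_cj (f : TA) : b (cj f) = cj (d f) := by
  ext z
  change _ = (starRingEnd ℂ) ((d f : ℂ → ℂ) z)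
  rw [d_apply, b_apply, wderiv, wderivBar, cj_fd, cj_fd]
  have h2 : (starRingEnd ℂ) 2 = 2 := Complex.conj_eq_iff_real.2 ⟨2, by simp⟩
  simp [sub_eq_add_neg, h2]

lemma N_eq (f : TA) : (N f : ℂ) = J (f * cj f) := by
  have : ((f * cj f : TA) : ℂ → ℂ) = fun z => ((‖(f : ℂ → ℂ) z‖ ^ 2 : ℝ) : ℂ) := by
    ext z
    change (f : ℂ → ℂ) z * (starRingEnd ℂ) ((f : ℂ → ℂ) z) = _
    rw [mul_conj, normSq_eq_norm_sq]
  change _ = II _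
  rw [this, N]
  unfold II
  simp only [intervalIntegral.integral_ofReal]

lemma N_d_b (f : TA) : N (d f) = N (b f) := by
  have : (N (d f) : ℂ) = N (b f) := by
    rw [N_eq, N_eq, ← b_cj, ← d_cj, J_d_parts, J_b_parts, d_b]
  exact_mod_cast this

end UD

namespace UD
open Complex

/-- families with all derivatives uniformly summable -/
def Good {ι : Type*} (u : ι → TA) : Prop :=
  ∀ k l : ℕ, ∃ B : ι → ℝ, Summable B ∧ ∀ i z, ‖((d^[k] (b^[l] (u i)) : TA) : ℂ → ℂ) z‖ ≤ B i

lemma d_b_iter (l : ℕ) (f : TA) : d (b^[l] f) = b^[l] (d f) := by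
  induction l generalizing f with
  | zero => rfl
  | succ l ih => rw [Function.iterate_succ_apply, Function.iterate_succ_apply, ih, d_b]

lemma Good.d {ι : Type*} {u : ι → TA} (h : Good u) : Good (fun i => d (u i)) := by
  intro k l
  obtain ⟨B, h1, h2⟩ := h (k + 1) l
  refine ⟨B, h1, fun i z => ?_⟩
  have := h2 i z
  rwa [Function.iterate_succ_apply, d_b_iter] at this

lemma Good.b {ι : Type*} {u : ι → TA} (h : Good u) : Good (fun i => b (u i)) := by
  intro k l
  obtain ⟨B, h1, h2⟩ := h k (l + 1)
  exact ⟨B, h1, fun i z => h2 i z⟩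

lemma Good.summable {ι : Type*} {u : ι → TA} (h : Good u) (z : ℂ) :
    Summable fun i => (u i : ℂ → ℂ) z := by
  obtain ⟨B, h1, h2⟩ := h 0 0
  exact Summable.of_norm_bounded h1 (fun i => h2 i z)

/-- the real-linear form `p dz + q dzbar` -/
noncomputable def frm (p q : ℂ) : ℂ →L[ℝ] ℂ :=
  p • (ContinuousLinearMap.id ℝ ℂ) + q • (conjCLE : ℂ →L[ℝ] ℂ)

lemma frm_apply (p q v : ℂ) : frm p q v = p * v + q * (starRingEnd ℂ) v := rfl

lemma frm_norm (p q : ℂ) : ‖frm p q‖ ≤ ‖p‖ + ‖q‖ := by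
  apply ContinuousLinearMap.opNorm_le_bound _ (by positivity)
  intro v
  rw [frm_apply]
  refine (norm_add_le _ _).trans ?_
  rw [norm_mul, norm_mul, RCLike.norm_conj, add_mul]

lemma fd_frm (f : TA) (z : ℂ) : fderiv ℝ (f : ℂ → ℂ) z = frm ((d f : ℂ → ℂ) z) ((b f : ℂ → ℂ) z) := by
  ext v
  have hv : v = v.re • (1:ℂ) + v.im • I := by simp
  rw [hv, map_add, map_add, map_smul, map_smul, map_smul, map_smul, fd_one, fd_I, frm_apply, frm_apply]
  simp
  ring

lemma Good.hasFDerivAt {ι : Type*} {u : ι → TA} (h : Good u) (z : ℂ) :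
    HasFDerivAt (fun z => ∑' i, (u i : ℂ → ℂ) z)
      (frm (∑' i, (UD.d (u i) : ℂ → ℂ) z) (∑' i, (UD.b (u i) : ℂ → ℂ) z)) z := by
  obtain ⟨B, h1, h2⟩ := h 1 0
  obtain ⟨B', h1', h2'⟩ := h 0 1
  have := hasFDerivAt_tsum (𝕜 := ℝ) (u := fun i => B i + B' i) (h1.add h1')
    (f := fun i => (u i : ℂ → ℂ)) (f' := fun i => fderiv ℝ (u i : ℂ → ℂ)) (x₀ := z)
    (fun i x => (diffb (u i) x).hasFDerivAt)
    (fun i x => by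
      rw [fd_frm]
      exact (frm_norm _ _).trans (add_le_add (h2 i x) (h2' i x))) (h.summable z) z
  suffices eq : frm (∑' i, (UD.d (u i) : ℂ → ℂ) z) (∑' i, (UD.b (u i) : ℂ → ℂ) z)
      = ∑' i, fderiv ℝ (u i : ℂ → ℂ) z by rw [eq]; exact this
  have s1 := (h.d.summable z)
  have s2 := (h.b.summable z)
  have hs : Summable fun i => fderiv ℝ (u i : ℂ → ℂ) z := by
    refine Summable.of_norm_bounded (h1.add h1') fun i => ?_
    rw [fd_frm]
    exact (frm_norm _ _).trans (add_le_add (h2 i z) (h2' i z))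
  refine ContinuousLinearMap.ext fun v => ?_
  have e : (∑' i, fderiv ℝ (u i : ℂ → ℂ) z) v = ∑' i, fderiv ℝ (u i : ℂ → ℂ) z v :=
    (ContinuousLinearMap.apply ℝ ℂ v).map_tsum hs
  rw [e]
  simp only [fd_frm, frm_apply]
  rw [Summable.tsum_add (s1.mul_right _) (s2.mul_right _), tsum_mul_right, tsum_mul_right]

lemma Good.contDiff {ι : Type*} (n : ℕ) {u : ι → TA} (h : Good u) :
    ContDiff ℝ n (fun z => ∑' i, (u i : ℂ → ℂ) z) := by
  induction n generalizing u with
  | zero =>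
    rw [Nat.cast_zero, contDiff_zero]
    exact continuous_iff_continuousAt.2 fun z => (h.hasFDerivAt z).continuousAt
  | succ n ih =>
    push_cast
    rw [contDiff_succ_iff_fderiv]
    refine ⟨fun z => (h.hasFDerivAt z).differentiableAt, by simp, ?_⟩
    have : fderiv ℝ (fun z => ∑' i, (u i : ℂ → ℂ) z) = fun z =>
      frm (∑' i, (UD.d (u i) : ℂ → ℂ) z) (∑' i, (UD.b (u i) : ℂ → ℂ) z) := by
      ext1 z
      exact (h.hasFDerivAt z).fderiv
    rw [this]
    unfold frm
    exact ((ih h.d).smul contDiff_const).add ((ih h.b).smul contDiff_const)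

lemma Good.sum {ι : Type*} {u : ι → TA} (h : Good u) : ∃ F : TA,
    (∀ z, HasSum (fun i => (u i : ℂ → ℂ) z) ((F : ℂ → ℂ) z)) ∧
    (∀ z, HasSum (fun i => (UD.d (u i) : ℂ → ℂ) z) ((UD.d F : ℂ → ℂ) z)) ∧
    (∀ z, HasSum (fun i => (UD.b (u i) : ℂ → ℂ) z) ((UD.b F : ℂ → ℂ) z)) := by
  let F : TA := ⟨fun z => ∑' i, (u i : ℂ → ℂ) z,
    contDiff_infty.2 fun n => h.contDiff n, fun z => by simp only [per1, per2, and_self]⟩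
  have hF : ∀ z, fderiv ℝ (F : ℂ → ℂ) z = _ := fun z => (h.hasFDerivAt z).fderiv
  refine ⟨F, fun z => (h.summable z).hasSum, fun z => ?_, fun z => ?_⟩
  · convert (h.d.summable z).hasSum using 1
    rw [d_apply, wderiv, hF, frm_apply, frm_apply]
    simp
    linear_combination (-(1/2) * ∑' i, (UD.d (u i) : ℂ → ℂ) z + (1/2) * ∑' i, (UD.b (u i) : ℂ → ℂ) z) * I_mul_I
  · convert (h.b.summable z).hasSum using 1
    rw [b_apply, wderivBar, hF, frm_apply, frm_apply]
    simp
    linear_combination ((1/2) * ∑' i, (UD.d (u i) : ℂ → ℂ) z - (1/2) * ∑' i, (UD.b (u i) : ℂ → ℂ) z) * I_mul_I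

end UD

namespace UD
open Complex

lemma four1 (u : ℝ → ℂ) (hc : Continuous u) (hp : ∀ x, u (x + 2 * Real.pi) = u x)
    (a : ℤ → ℂ) (ha : ∀ n : ℤ, a n = (2 * Real.pi : ℂ)⁻¹ * ∫ x in (0:ℝ)..2 * Real.pi, exp (-(I * (n * x))) * u x)
    (hs : Summable a) (x : ℝ) : HasSum (fun n : ℤ => a n * exp (I * (n * x))) (u x) := by
  have : Fact (0 < 2 * Real.pi) := ⟨by positivity⟩
  have hp' : Function.Periodic u (2 * Real.pi) := hp
  let F : C(AddCircle (2 * Real.pi), ℂ) := ⟨hp'.lift, continuous_coinduced_dom.mpr hc⟩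
  have hF : ∀ x : ℝ, F x = u x := fun x => hp'.lift_coe x
  have hpi : (Real.pi : ℂ) ≠ 0 := by exact_mod_cast Real.pi_ne_zero
  have hcoef : fourierCoeff F = a := by
    ext n
    rw [fourierCoeff_eq_intervalIntegral F n 0, ha, zero_add, real_smul]
    congr 1
    · push_cast; simp
    · apply intervalIntegral.integral_congr
      intro t _
      simp only [hF, fourier_coe_apply, smul_eq_mul]
      congr 2
      push_cast
      field_simp
  have := has_pointwise_sum_fourier_series_of_summable (f := F) (by rw [hcoef]; exact hs) x
  rw [hF, hcoef] at this
  convert this using 2 with n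
  rw [fourier_coe_apply, smul_eq_mul]
  congr 2
  push_cast
  field_simp

/-- exponentials -/
noncomputable def e (p : ℤ × ℤ) : TA := ⟨fun z => exp (I * (p.1 * z.re + p.2 * z.im)), by
  constructor
  · have h1 : ContDiff ℝ (⊤ : ℕ∞) (fun z : ℂ => (z.re : ℂ)) :=
      ofRealCLM.contDiff.comp reCLM.contDiff
    have h2 : ContDiff ℝ (⊤ : ℕ∞) (fun z : ℂ => (z.im : ℂ)) :=
      ofRealCLM.contDiff.comp imCLM.contDiff
    exact (contDiff_const.mul ((contDiff_const.mul h1).add (contDiff_const.mul h2))).cexp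
  · intro z
    constructor
    · rw [exp_eq_exp_iff_exists_int]
      refine ⟨p.1, ?_⟩
      simp
      ring
    · rw [exp_eq_exp_iff_exists_int]
      refine ⟨p.2, ?_⟩
      simp
      ring⟩

lemma e_apply (p : ℤ × ℤ) (z : ℂ) : (e p : ℂ → ℂ) z = exp (I * (p.1 * z.re + p.2 * z.im)) := rfl

lemma e_norm (p : ℤ × ℤ) (z : ℂ) : ‖(e p : ℂ → ℂ) z‖ = 1 := by
  rw [e_apply, mul_comm]
  have : ((p.1 : ℂ) * z.re + p.2 * z.im) = ((p.1 * z.re + p.2 * z.im : ℝ) : ℂ) := by push_cast; rfl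
  rw [this, norm_exp_ofReal_mul_I]

/-- symbol of d -/
noncomputable def la (p : ℤ × ℤ) : ℂ := (I * p.1 + p.2) / 2
/-- symbol of b -/
noncomputable def ka (p : ℤ × ℤ) : ℂ := (I * p.1 - p.2) / 2

lemma e_fd (p : ℤ × ℤ) (z v : ℂ) :
    fderiv ℝ (e p : ℂ → ℂ) z v = (e p : ℂ → ℂ) z * (I * (p.1 * v.re + p.2 * v.im)) := by
  have h1 : HasFDerivAt (fun z : ℂ => (z.re : ℂ)) (ofRealCLM.comp reCLM) z :=
    (ofRealCLM.comp reCLM).hasFDerivAt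
  have h2 : HasFDerivAt (fun z : ℂ => (z.im : ℂ)) (ofRealCLM.comp imCLM) z :=
    (ofRealCLM.comp imCLM).hasFDerivAt
  have := (((h1.const_mul (p.1 : ℂ)).add (h2.const_mul (p.2 : ℂ))).const_mul I).cexp
  have h3 := this.fderiv
  change fderiv ℝ (e p : ℂ → ℂ) z = _ at h3
  rw [h3]
  rfl

lemma d_e (p : ℤ × ℤ) : d (e p) = la p • e p := by
  ext z
  change _ = la p * (e p : ℂ → ℂ) z
  rw [d_apply, wderiv, e_fd, e_fd, la]
  simp
  linear_combination (-(e p : ℂ → ℂ) z * p.2 / 2) * I_mul_I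
lemma b_e (p : ℤ × ℤ) : b (e p) = ka p • e p := by
  ext z
  change _ = ka p * (e p : ℂ → ℂ) z
  rw [b_apply, wderivBar, e_fd, e_fd, ka]
  simp
  linear_combination ((e p : ℂ → ℂ) z * p.2 / 2) * I_mul_I

/-- Fourier coefficients -/
noncomputable def co (f : TA) (p : ℤ × ℤ) : ℂ := ((2 * Real.pi : ℂ) ^ 2)⁻¹ * J (f * e (-p))

lemma co_d (f : TA) (p : ℤ × ℤ) : co (d f) p = la p * co f p := by
  unfold co
  rw [J_d_parts, d_e, mul_smul_comm, map_smul]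
  simp [la]
  ring
lemma co_b (f : TA) (p : ℤ × ℤ) : co (b f) p = ka p * co f p := by
  unfold co
  rw [J_b_parts, b_e, mul_smul_comm, map_smul]
  simp [ka]
  ring

/-- weight -/
noncomputable def W (p : ℤ × ℤ) : ℝ := 1 + (p.1 : ℝ) ^ 2 + (p.2 : ℝ) ^ 2

lemma W_pos (p : ℤ × ℤ) : 1 ≤ W p := by
  unfold W; nlinarith [sq_nonneg (p.1 : ℝ), sq_nonneg (p.2 : ℝ)]

/-- elliptic operator -/
noncomputable def L (f : TA) : TA := f - (4 : ℂ) • d (b f)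

lemma co_L (f : TA) (p : ℤ × ℤ) : co (L f) p = W p * co f p := by
  have : co (L f) p = co f p - 4 * co (d (b f)) p := by
    simp only [co, L]
    rw [sub_mul, map_sub, smul_mul_assoc, map_smul, smul_eq_mul]
    ring
  rw [this, co_d, co_b, la, ka, W]
  push_cast
  linear_combination (-(p.1 : ℂ) ^ 2 * co f p) * I_mul_I

lemma co_Lk (k : ℕ) (f : TA) (p : ℤ × ℤ) : co (L^[k] f) p = (W p : ℂ) ^ k * co f p := by
  induction k with
  | zero => simp
  | succ k ih => rw [Function.iterate_succ_apply', co_L, ih]; ring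

lemma N_mul_e (f : TA) (p : ℤ × ℤ) : N (f * e p) = N f := by
  unfold N
  congr 1
  ext z
  change ‖(f : ℂ → ℂ) z * (e p : ℂ → ℂ) z‖ ^ 2 = _
  rw [norm_mul, e_norm, mul_one]

lemma co_le (f : TA) (p : ℤ × ℤ) {ε : ℝ} (hε : 0 < ε) : ‖co f p‖ ≤ ε + ε⁻¹ * N f := by
  unfold co
  have h := J_le (f * e (-p)) hε
  rw [N_mul_e] at h
  have hP : 1 ≤ (2 * Real.pi) ^ 2 := by nlinarith [Real.pi_gt_three]
  have h0 : 0 ≤ ε⁻¹ * N f := mul_nonneg (by positivity) (N_nonneg f)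
  rw [norm_mul, norm_inv, norm_pow]
  have : ‖(2 * Real.pi : ℂ)‖ = 2 * Real.pi := by
    rw [norm_mul, norm_real, Real.norm_of_nonneg Real.pi_pos.le]; simp
  rw [this, inv_mul_le_iff₀ (by positivity)]
  nlinarith

lemma co_decay (k : ℕ) (f : TA) (p : ℤ × ℤ) {ε : ℝ} (hε : 0 < ε) :
    ‖co f p‖ ≤ (ε + ε⁻¹ * N (L^[k] f)) * ((W p) ^ k)⁻¹ := by
  have hw := W_pos p
  have := co_le (L^[k] f) p hε
  rw [co_Lk, norm_mul, norm_pow, norm_real, Real.norm_of_nonneg (by linarith)] at this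
  rw [← div_eq_mul_inv, le_div_iff₀ (by positivity)]
  linarith

lemma sumW : Summable fun p : ℤ × ℤ => ((W p) ^ 2)⁻¹ := by
  have h1 : Summable fun n : ℤ => (1 + (n : ℝ) ^ 2)⁻¹ := by
    have : Summable fun n : ℤ => 1 / (n : ℝ) ^ 2 := Real.summable_one_div_int_pow.2 (by norm_num)
    rw [← (Finset.summable_compl_iff ({0} : Finset ℤ))]
    rw [← (Finset.summable_compl_iff ({0} : Finset ℤ))] at this
    refine Summable.of_nonneg_of_le (fun n => by positivity) (fun n => ?_) this
    have hn : (n : ℤ) ≠ 0 := by simpa using n.2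
    have : 0 < ((n : ℤ) : ℝ) ^ 2 := by positivity
    rw [one_div]
    gcongr
    linarith
  have h2 := h1.mul_of_nonneg h1 (fun n => by positivity) (fun n => by positivity)
  refine Summable.of_nonneg_of_le (fun n => by positivity) (fun p => ?_) h2
  rw [← mul_inv]
  gcongr
  unfold W
  nlinarith [sq_nonneg (p.1 : ℝ), sq_nonneg (p.2 : ℝ), mul_nonneg (sq_nonneg (p.1 : ℝ)) (sq_nonneg (p.2 : ℝ)),
    sq_nonneg ((p.1 : ℝ)^2), sq_nonneg ((p.2 : ℝ)^2)]

lemma co_summable (f : TA) : Summable fun p => ‖co f p‖ :=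
  Summable.of_nonneg_of_le (fun _ => norm_nonneg _) (fun p => co_decay 2 f p one_pos)
    (sumW.mul_left _)

lemma fourier_sum (f : TA) (z : ℂ) : HasSum (fun p => co f p * (e p : ℂ → ℂ) z) ((f : ℂ → ℂ) z) := by
  set A : ℤ → ℝ → ℂ := fun m y => (2 * Real.pi : ℂ)⁻¹ *
    ∫ x in (0:ℝ)..2 * Real.pi, exp (-(I * (m * x))) * (f : ℂ → ℂ) (x + y * I) with hA
  have hf := cont f
  have hcs := (co_summable f)
  have hA1 : ∀ m y, HasSum (fun n : ℤ => co f (m, n) * exp (I * (n * (y : ℝ)))) (A m y) := by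
    intro m
    refine four1 (A m) ?_ ?_ (fun n => co f (m, n)) ?_ ?_
    · refine continuous_const.mul ?_
      apply intervalIntegral.continuous_parametric_intervalIntegral_of_continuous'
      simp only [Function.uncurry_def]
      fun_prop
    · intro y
      simp only [hA]
      congr 2
      ext x
      have := per2 f (x + y * I)
      rw [← this]
      push_cast
      congr 2
      ring_nf
    · intro n
      simp only [co, hA]
      change _ * II _ = _
      unfold II
      have : ∀ y : ℝ, exp (-(I * (n * y))) * ((2 * Real.pi : ℂ)⁻¹ * ∫ x in (0:ℝ)..2 * Real.pi,
          exp (-(I * (m * x))) * (f : ℂ → ℂ) (x + y * I)) = (2 * Real.pi : ℂ)⁻¹ *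
          ∫ x in (0:ℝ)..2 * Real.pi, ((f * e (-(m, n)) : TA) : ℂ → ℂ) (x + y * I) := by
        intro y
        rw [mul_left_comm, ← intervalIntegral.integral_const_mul]
        congr 2
        ext x
        change _ = (f : ℂ → ℂ) _ * (e (-(m, n)) : ℂ → ℂ) _
        rw [e_apply, ← mul_assoc, ← exp_add, mul_comm]
        congr 2
        simp
        ring
      simp only [this]
      rw [intervalIntegral.integral_const_mul, ← mul_assoc]
      congr 1
      rw [sq, mul_inv]
    · exact (hcs.prod_factor m).of_norm
  have hsumA : ∀ y, Summable fun m => A m y := by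
    intro y
    refine Summable.of_norm_bounded hcs.prod fun m => ?_
    rw [← (hA1 m y).tsum_eq]
    have hn : ∀ n : ℤ, ‖co f (m, n) * exp (I * (n * (y : ℝ)))‖ = ‖co f (m, n)‖ := by
      intro n
      have : I * (n * (y : ℝ)) = ((n * y : ℝ) : ℂ) * I := by push_cast; ring
      rw [norm_mul, this, norm_exp_ofReal_mul_I, mul_one]
    refine (norm_tsum_le_tsum_norm ?_).trans (le_of_eq ?_)
    · simp only [hn]
      exact hcs.prod_factor m
    · simp only [hn]
  have hA2 : HasSum (fun m : ℤ => A m z.im * exp (I * (m * (z.re : ℝ)))) ((f : ℂ → ℂ) z) := by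
    have := four1 (fun x => (f : ℂ → ℂ) (x + z.im * I)) (by fun_prop) ?_ (fun m => A m z.im)
      (fun m => by simp only [hA]) (hsumA _) z.re
    · simpa only [re_add_im] using this
    · intro x
      rw [← per1 f (x + z.im * I)]
      push_cast
      congr 1
      ring_nf
  have hS : Summable fun p => co f p * (e p : ℂ → ℂ) z := by
    apply Summable.of_norm
    simpa only [norm_mul, e_norm, mul_one] using hcs
  have := hS.hasSum.prod_fiberwise (fun m => by
    have := (hA1 m z.im).mul_right (exp (I * (m * (z.re : ℝ))))
    have e2 : (fun n : ℤ => co f (m, n) * exp (I * (n * (z.im : ℝ))) * exp (I * (m * (z.re : ℝ))))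
      = fun n : ℤ => co f (m, n) * (e (m, n) : ℂ → ℂ) z := by
      ext n
      rw [e_apply, mul_assoc, ← exp_add]
      congr 2
      ring
    rw [e2] at this
    exact this)
  rw [hA2.unique this]
  exact hS.hasSum

end UD

namespace UD
open Complex

lemma ka_conj (p : ℤ × ℤ) : (starRingEnd ℂ) (ka p) = - la p := by
  have h2 : (starRingEnd ℂ) 2 = 2 := Complex.conj_eq_iff_real.2 ⟨2, by simp⟩
  simp [ka, la, h2]
  ring
lemma ka_norm (p : ℤ × ℤ) : ‖ka p‖ = ‖la p‖ := by
  rw [← RCLike.norm_conj, ka_conj, norm_neg]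

lemma la_sq (p : ℤ × ℤ) : (2 * ‖la p‖) ^ 2 = (p.1 : ℝ) ^ 2 + (p.2 : ℝ) ^ 2 := by
  rw [mul_pow, ← normSq_eq_norm_sq, normSq_apply, la]
  have h1 : ((I * p.1 + p.2) / 2 : ℂ).re = p.2 / 2 := by simp
  have h2 : ((I * p.1 + p.2) / 2 : ℂ).im = p.1 / 2 := by simp
  rw [h1, h2]
  ring

lemma la_le (p : ℤ × ℤ) : ‖la p‖ ≤ W p := by
  have h := la_sq p
  unfold W
  nlinarith [sq_nonneg (2 * ‖la p‖ - 1), norm_nonneg (la p)]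

lemma la_ge (p : ℤ × ℤ) (hp : p ≠ 0) : 1 ≤ 2 * ‖la p‖ := by
  have h := la_sq p
  have h3 : (1 : ℤ) ≤ p.1 ^ 2 + p.2 ^ 2 := by
    by_contra! hlt
    apply hp
    have h1 : p.1 ^ 2 = 0 := by nlinarith [sq_nonneg p.1, sq_nonneg p.2]
    have h2 : p.2 ^ 2 = 0 := by nlinarith [sq_nonneg p.1, sq_nonneg p.2]
    exact Prod.ext (by simpa using h1) (by simpa using h2)
  have h4 : (1 : ℝ) ≤ (p.1 : ℝ) ^ 2 + (p.2 : ℝ) ^ 2 := by exact_mod_cast h3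
  rw [← h] at h4
  have := norm_nonneg (la p)
  nlinarith

lemma d_iter_e (k : ℕ) (p : ℤ × ℤ) (c : ℂ) : d^[k] (c • e p) = (c * la p ^ k) • e p := by
  induction k with
  | zero => simp
  | succ k ih => rw [Function.iterate_succ_apply', ih, Derivation.map_smul, d_e, smul_smul]; congr 1; ring
lemma b_iter_e (k : ℕ) (p : ℤ × ℤ) (c : ℂ) : b^[k] (c • e p) = (c * ka p ^ k) • e p := by
  induction k with
  | zero => simp
  | succ k ih => rw [Function.iterate_succ_apply', ih, Derivation.map_smul, b_e, smul_smul]; congr 1; ring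

lemma solve (h : TA) : ∃ w : TA, b w = d h := by
  set u : ℤ × ℤ → TA := fun p => (la p / ka p * co h p) • e p with hu
  have hg : Good u := by
    intro k l
    refine ⟨fun p => (1 + 1⁻¹ * N (L^[k + l + 2] h)) * ((W p) ^ 2)⁻¹, sumW.mul_left _, fun p z => ?_⟩
    simp only [hu]
    rw [b_iter_e, d_iter_e]
    change ‖_ * (e p : ℂ → ℂ) z‖ ≤ _
    have hw := W_pos p
    have hc := co_decay (k + l + 2) h p one_pos
    have h1 : ‖la p / ka p‖ ≤ 1 := by
      rw [norm_div, ka_norm]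
      exact div_self_le_one _
    have hl := la_le p
    have hk := hl
    rw [← ka_norm] at hk
    rw [norm_mul, e_norm, mul_one, norm_mul, norm_mul, norm_mul, norm_pow, norm_pow]
    calc ‖la p / ka p‖ * ‖co h p‖ * ‖ka p‖ ^ l * ‖la p‖ ^ k
        ≤ 1 * ((1 + 1⁻¹ * N (L^[k + l + 2] h)) * ((W p) ^ (k + l + 2))⁻¹) * W p ^ l * W p ^ k := by
          have hN := N_nonneg (L^[k + l + 2] h)
          gcongr
      _ = _ := by
          rw [pow_add, pow_add]
          field_simp
  obtain ⟨w, -, -, h3⟩ := hg.sum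
  refine ⟨w, ?_⟩
  ext z
  refine (h3 z).unique ?_
  convert fourier_sum (d h) z using 2 with p
  simp only [hu]
  rw [Derivation.map_smul, b_e, co_d, smul_smul]
  change _ * (e p : ℂ → ℂ) z = _
  congr 1
  by_cases h0 : ka p = 0
  · have : la p = 0 := by rw [← norm_eq_zero, ← ka_norm, h0, norm_zero]
    simp [h0, this]
  · field_simp

/-! ### boundedness -/

lemma exists_max (f : TA) : ∃ z0, ∀ z, ‖(f : ℂ → ℂ) z‖ ≤ ‖(f : ℂ → ℂ) z0‖ := by
  have hK : IsCompact (Set.Icc (0:ℝ) (2 * Real.pi) ×ℂ Set.Icc (0:ℝ) (2 * Real.pi)) :=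
    IsCompact.reProdIm isCompact_Icc isCompact_Icc
  obtain ⟨z0, -, h0⟩ := hK.exists_isMaxOn ⟨0, by simp [mem_reProdIm, Real.pi_pos.le]⟩
    ((cont f).norm.continuousOn)
  refine ⟨z0, fun z => ?_⟩
  have hp : (0:ℝ) < 2 * Real.pi := by positivity
  have p1 : Function.Periodic (f : ℂ → ℂ) (2 * Real.pi) := per1 f
  have p2 : Function.Periodic (f : ℂ → ℂ) (2 * Real.pi * I) := per2 f
  set m := toIcoDiv hp 0 z.re
  set n := toIcoDiv hp 0 z.im
  have e1 : (f : ℂ → ℂ) (z - m • (2 * Real.pi : ℂ) - n • (2 * Real.pi * I : ℂ)) = (f : ℂ → ℂ) z := by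
    rw [p2.sub_zsmul_eq, p1.sub_zsmul_eq]
  rw [← e1]
  apply h0
  have m1 := sub_toIcoDiv_zsmul_mem_Ico hp 0 z.re
  have m2 := sub_toIcoDiv_zsmul_mem_Ico hp 0 z.im
  rw [zero_add] at m1 m2
  rw [mem_reProdIm]
  constructor
  · convert Set.Ico_subset_Icc_self m1 using 1
    simp [m]
  · convert Set.Ico_subset_Icc_self m2 using 1
    simp [n]

/-! ### L2 algebra -/

lemma N_add_le (f g : TA) {δ : ℝ} (hδ : 0 < δ) : N (f + g) ≤ (1 + δ) * N f + (1 + δ⁻¹) * N g := by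
  apply N_comb
  intro z
  change ‖(f : ℂ → ℂ) z + (g : ℂ → ℂ) z‖ ^ 2 ≤ _
  set x := ‖(f : ℂ → ℂ) z‖
  set y := ‖(g : ℂ → ℂ) z‖
  have h1 : ‖(f : ℂ → ℂ) z + (g : ℂ → ℂ) z‖ ^ 2 ≤ (x + y) ^ 2 := by
    gcongr
    exact norm_add_le _ _
  have hi : 0 < δ⁻¹ := by positivity
  have h := mul_nonneg hi.le (sq_nonneg (δ * x - y))
  have e : δ⁻¹ * (δ * x - y) ^ 2 = δ * x ^ 2 - 2 * x * y + δ⁻¹ * y ^ 2 := by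
    field_simp
    ring
  nlinarith

lemma N_mul_le (c f : TA) (M : ℝ) (hM : ∀ z, ‖(c : ℂ → ℂ) z‖ ≤ M) : N (c * f) ≤ M ^ 2 * N f := by
  have := N_comb (c * f) f f (M ^ 2) 0 (fun z => by
    change ‖(c : ℂ → ℂ) z * (f : ℂ → ℂ) z‖ ^ 2 ≤ _
    rw [norm_mul, mul_pow, zero_mul, add_zero]
    gcongr
    exact hM z)
  linarith

lemma N_smul (c : ℂ) (f : TA) : N (c • f) = ‖c‖ ^ 2 * N f := by
  unfold N
  rw [← smul_eq_mul, ← II_smul]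
  congr 1
  ext z
  change ‖c * (f : ℂ → ℂ) z‖ ^ 2 = _
  rw [norm_mul, mul_pow, smul_eq_mul]

lemma b_d_iter (s : ℕ) (f : TA) : b (d^[s] f) = d^[s] (b f) := by
  induction s generalizing f with
  | zero => rfl
  | succ l ih => rw [Function.iterate_succ_apply, Function.iterate_succ_apply, ih, d_b]

lemma N_db_iter (k l : ℕ) (f : TA) : N (d^[k] (b^[l] f)) = N (d^[k + l] f) := by
  induction l generalizing f k with
  | zero => rfl
  | succ l ih =>
    rw [Function.iterate_succ_apply, ih, ← b_d_iter, ← N_d_b]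
    exact congrArg N (Function.iterate_succ_apply' (⇑d) (k + l) f).symm

lemma N_L (f : TA) : N (L f) ≤ 2 * N f + 32 * N (d^[2] f) := by
  have h := N_add_le f ((-4 : ℂ) • d (b f)) one_pos
  rw [N_smul] at h
  have h2 : N (d (b f)) = N (d^[2] f) := N_db_iter 1 1 f
  have h3 : L f = f + (-4 : ℂ) • d (b f) := by
    rw [L, neg_smul, sub_eq_add_neg]
  rw [h3]
  rw [h2] at h
  have h4 : ‖(-4:ℂ)‖ ^ 2 = 16 := by norm_num
  have h5 : (1:ℝ) + 1⁻¹ = 2 := by norm_num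
  rw [h4, h5] at h
  linarith

lemma d_L (f : TA) : d (L f) = L (d f) := by
  rw [L, L, map_sub, Derivation.map_smul, d_b]

lemma N_L2 (f : TA) : N (L^[2] f) ≤ 4 * N f + 128 * N (d^[2] f) + 1024 * N (d^[4] f) := by
  have h1 := N_L (L f)
  have h2 := N_L f
  have h3 := N_L (d^[2] f)
  have e1 : d^[2] (L f) = L (d^[2] f) := by
    change d (d (L f)) = L (d (d f))
    rw [d_L, d_L]
  rw [e1] at h1
  have e2 : d^[2] (d^[2] f) = d^[4] f := rfl
  rw [e2] at h3
  change N (L (L f)) ≤ _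
  linarith

lemma comm_le (s : ℕ) (c : TA) : ∃ C : ℝ, 0 ≤ C ∧ ∀ v : TA,
    N (d^[s] (c * v) - c * d^[s] v) ≤ C * ∑ j ∈ Finset.range s, N (d^[j] v) := by
  induction s generalizing c with
  | zero =>
    refine ⟨0, le_rfl, fun v => ?_⟩
    simp [N, II]
  | succ s ih =>
    obtain ⟨C1, h1, H1⟩ := ih (d c)
    obtain ⟨C2, h2, H2⟩ := ih c
    obtain ⟨z0, hz⟩ := exists_max (d c)
    set M := ‖(d c : ℂ → ℂ) z0‖
    refine ⟨4 * C1 + 4 * M ^ 2 + 2 * C2, by positivity, fun v => ?_⟩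
    have hd : ∀ s, ∀ x y : TA, d^[s] (x + y) = d^[s] x + d^[s] y := by
      intro s
      induction s with
      | zero => intro x y; rfl
      | succ s ih => intro x y; rw [Function.iterate_succ_apply, map_add, ih]; rfl
    have e1 : d^[s + 1] (c * v) - c * d^[s + 1] v =
        ((d^[s] (d c * v) - d c * d^[s] v) + d c * d^[s] v) +
          (d^[s] (c * d v) - c * d^[s] (d v)) := by
      rw [Function.iterate_succ_apply, Function.iterate_succ_apply, Derivation.leibniz, hd]
      simp only [smul_eq_mul]
      rw [mul_comm v]
      ring
    rw [e1]
    have a1 := N_add_le ((d^[s] (d c * v) - d c * d^[s] v) + d c * d^[s] v)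
          (d^[s] (c * d v) - c * d^[s] (d v)) one_pos
    have a2 := N_add_le (d^[s] (d c * v) - d c * d^[s] v) (d c * d^[s] v) one_pos
    have a3 := N_mul_le (d c) (d^[s] v) M hz
    have b1 := H1 v
    have b2 := H2 (d v)
    set S := ∑ j ∈ Finset.range (s + 1), N (d^[j] v) with hS
    have s1 : ∑ j ∈ Finset.range s, N (d^[j] v) ≤ S := by
      rw [hS, Finset.sum_range_succ]
      linarith [N_nonneg (d^[s] v)]
    have s2 : ∑ j ∈ Finset.range s, N (d^[j] (d v)) ≤ S := by
      rw [hS, Finset.sum_range_succ']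
      simp only [Function.iterate_succ_apply]
      linarith [N_nonneg (d^[0] v)]
    have s3 : N (d^[s] v) ≤ S := by
      rw [hS, Finset.sum_range_succ]
      linarith [Finset.sum_nonneg (s := Finset.range s) (f := fun j => N (d^[j] v))
        (fun j _ => N_nonneg _)]
    have t1 := mul_le_mul_of_nonneg_left s1 h1
    have t2 := mul_le_mul_of_nonneg_left s2 h2
    have t3 := mul_le_mul_of_nonneg_left s3 (sq_nonneg M)
    have h5 : (1:ℝ) + 1⁻¹ = 2 := by norm_num
    have h6 : (1:ℝ) + 1 = 2 := by norm_num
    rw [h5, h6] at a1 a2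
    linarith

/-! ### geometric decay -/

/-- geometric decay -/
def Dec (a : ℕ → ℝ) : Prop := ∃ C r : ℝ, 0 ≤ C ∧ 0 < r ∧ r < 1 ∧ ∀ n, a n ≤ C * r ^ n

lemma Dec.mono {a c : ℕ → ℝ} (h : Dec a) (H : ∀ n, c n ≤ a n) : Dec c := by
  obtain ⟨C, r, h0, h1, h2, h3⟩ := h
  exact ⟨C, r, h0, h1, h2, fun n => (H n).trans (h3 n)⟩

lemma Dec.add {a c : ℕ → ℝ} (h : Dec a) (h' : Dec c) : Dec (fun n => a n + c n) := by
  obtain ⟨C, r, h0, h1, h2, h3⟩ := h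
  obtain ⟨C', r', h0', h1', h2', h3'⟩ := h'
  refine ⟨C + C', max r r', by positivity, by positivity, max_lt h2 h2', fun n => ?_⟩
  have e1 : r ^ n ≤ (max r r') ^ n := by gcongr; exact le_max_left _ _
  have e2 : r' ^ n ≤ (max r r') ^ n := by gcongr; exact le_max_right _ _
  have := mul_le_mul_of_nonneg_left e1 h0
  have := mul_le_mul_of_nonneg_left e2 h0'
  linarith [h3 n, h3' n]

lemma Dec.mul {a : ℕ → ℝ} (h : Dec a) {c : ℝ} (hc : 0 ≤ c) : Dec (fun n => c * a n) := by
  obtain ⟨C, r, h0, h1, h2, h3⟩ := h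
  refine ⟨c * C, r, by positivity, h1, h2, fun n => ?_⟩
  rw [mul_assoc]
  exact mul_le_mul_of_nonneg_left (h3 n) hc

lemma Dec.zero : Dec (fun _ => 0) := ⟨0, 1 / 2, le_rfl, by norm_num, by norm_num, by simp⟩

lemma Dec.sum {a : ℕ → ℕ → ℝ} (s : ℕ) (h : ∀ j < s, Dec (a j)) :
    Dec (fun n => ∑ j ∈ Finset.range s, a j n) := by
  induction s with
  | zero => simpa using Dec.zero
  | succ s ih =>
    simp only [Finset.sum_range_succ]
    exact (ih fun j hj => h j (by omega)).add (h s (by omega))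

lemma Dec.recur {a c : ℕ → ℝ} (h : Dec c) {q : ℝ} (hq0 : 0 ≤ q) (hq : q < 1)
    (H : ∀ n, a (n + 1) ≤ q * a n + c n) : Dec a := by
  obtain ⟨C, r, h0, h1, h2, h3⟩ := h
  set m := max q r
  have hm : m < 1 := max_lt hq h2
  have hqm : q ≤ m := le_max_left _ _
  have hrm : r ≤ m := le_max_right _ _
  set ρ := (m + 1) / 2 with hρ
  have hρ1 : ρ < 1 := by rw [hρ]; linarith
  have hρm : m < ρ := by rw [hρ]; linarith
  have hρ0 : 0 < ρ := by linarith
  set D := max (a 0) (C / (ρ - q)) with hD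
  have hD0 : 0 ≤ D := le_trans (div_nonneg h0 (by linarith)) (le_max_right _ _)
  have hD1 : C ≤ D * (ρ - q) := by
    rw [← div_le_iff₀ (by linarith)]
    exact le_max_right _ _
  refine ⟨D, ρ, hD0, hρ0, hρ1, fun n => ?_⟩
  induction n with
  | zero => simp [hD]
  | succ n ih =>
    have e1 := H n
    have e2 := mul_le_mul_of_nonneg_left ih hq0
    have e3 := h3 n
    have e4 : r ^ n ≤ ρ ^ n := by gcongr; linarith
    have e5 := mul_le_mul_of_nonneg_left e4 h0
    have e6 := mul_le_mul_of_nonneg_right hD1 (by positivity : 0 ≤ ρ ^ n)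
    rw [pow_succ]
    nlinarith

lemma dec_main (μ : TA) (hμ : ∀ z, ‖(μ : ℂ → ℂ) z‖ < 1) (v : ℕ → TA)
    (hv : ∀ n, b (v (n + 1)) = μ * d (v n)) (s : ℕ) : Dec fun n => N (d^[s + 1] (v n)) := by
  obtain ⟨z0, hz⟩ := exists_max μ
  set k := ‖(μ : ℂ → ℂ) z0‖ with hk
  have hk1 : k < 1 := hμ z0
  have hk0 : 0 ≤ k := norm_nonneg _
  have hk2 : k ^ 2 < 1 := by nlinarith
  set δ := (1 - k ^ 2) / 2 with hδ
  have hδ0 : 0 < δ := by rw [hδ]; linarith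
  induction s using Nat.strong_induction_on with
  | _ s ih =>
  obtain ⟨C, hC, HC⟩ := comm_le s μ
  have hsum := (Dec.sum (a := fun j n => N (d^[j + 1] (v n))) s ih).mul
    (by positivity : 0 ≤ (1 + δ⁻¹) * C)
  refine hsum.recur (q := (1 + δ) * k ^ 2) (by positivity) (by rw [hδ]; nlinarith) fun n => ?_
  have e1 : N (d^[s + 1] (v (n + 1))) = N (d^[s] (μ * d (v n))) := by
    rw [← hv, Function.iterate_succ_apply', N_d_b, b_d_iter]
  rw [e1]
  have e2 := N_add_le (μ * d^[s] (d (v n))) (d^[s] (μ * d (v n)) - μ * d^[s] (d (v n))) hδ0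
  rw [add_sub_cancel] at e2
  have e3 := N_mul_le μ (d^[s] (d (v n))) k hz
  have e4 := HC (d (v n))
  simp only [Function.iterate_succ_apply]
  have e5 := mul_le_mul_of_nonneg_left e3 (by positivity : 0 ≤ 1 + δ)
  have e6 := mul_le_mul_of_nonneg_left e4 (by positivity : 0 ≤ 1 + δ⁻¹)
  linarith

lemma sup_dec (w : ℕ → TA) (h : Dec fun n => N (L^[2] (w n))) :
    ∃ B : ℕ → ℝ, Summable B ∧ ∀ n p, ‖co (w n) p‖ ≤ B n * ((W p) ^ 2)⁻¹ := by
  obtain ⟨C, r, h0, h1, h2, h3⟩ := h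
  set q := Real.sqrt r
  have hq : 0 < q := Real.sqrt_pos.2 h1
  have hq1 : q < 1 := by rw [Real.sqrt_lt' one_pos]; simpa using h2
  have hqq : q ^ 2 = r := Real.sq_sqrt h1.le
  refine ⟨fun n => (1 + C) * q ^ n, (summable_geometric_of_lt_one hq.le hq1).mul_left _, fun n p => ?_⟩
  have := W_pos p
  refine (co_decay 2 (w n) p (pow_pos hq n)).trans ?_
  gcongr
  have h4 : (q ^ n)⁻¹ * N (L^[2] (w n)) ≤ (q ^ n)⁻¹ * (C * r ^ n) := by
    gcongr
    exact h3 n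
  have h5 : (q ^ n)⁻¹ * (C * r ^ n) = C * q ^ n := by
    rw [← hqq, ← pow_mul, mul_comm 2 n, pow_mul]
    field_simp
  linarith

lemma dec_L (v : ℕ → TA) (h : ∀ s, Dec fun n => N (d^[s + 1] (v n))) (k l : ℕ) (hkl : k + l ≠ 0) :
    Dec fun n => N (L^[2] (d^[k] (b^[l] (v n)))) := by
  have key : ∀ j, Dec fun n => N (d^[j] (d^[k] (b^[l] (v n)))) := by
    intro j
    obtain ⟨m, hm⟩ := Nat.exists_eq_succ_of_ne_zero hkl
    refine (h (j + m)).mono fun n => le_of_eq ?_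
    have e : j + k + l = j + m + 1 := by omega
    rw [← Function.iterate_add_apply, N_db_iter, e]
  exact ((((key 0).mul (c := 4) (by norm_num)).add ((key 2).mul (c := 128) (by norm_num))).add
    ((key 4).mul (c := 1024) (by norm_num))).mono fun n => N_L2 _

lemma good_main (v : ℕ → TA) (h : ∀ s, Dec fun n => N (d^[s + 1] (v n))) :
    Good fun n => v n - co (v n) 0 • (1 : TA) := by
  have kd : ∀ n, d (v n - co (v n) 0 • (1 : TA)) = d (v n) := by
    intro n; rw [map_sub, Derivation.map_smul, Derivation.map_one_eq_zero]; simp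
  have kb : ∀ n, b (v n - co (v n) 0 • (1 : TA)) = b (v n) := by
    intro n; rw [map_sub, Derivation.map_smul, Derivation.map_one_eq_zero]; simp
  obtain ⟨K, hK⟩ := sumW
  intro k l
  by_cases hkl : k + l = 0
  · obtain ⟨rfl, rfl⟩ : k = 0 ∧ l = 0 := by omega
    obtain ⟨B, hB, H⟩ := sup_dec (fun n => d^[1] (b^[0] (v n))) (dec_L v h 1 0 (by norm_num))
    have hB2 : Summable fun n => 2 * B n * K := (hB.mul_left 2).mul_right K
    refine ⟨fun n => 2 * B n * K, hB2, fun n z => ?_⟩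
    change ‖(v n : ℂ → ℂ) z - co (v n) 0 * 1‖ ≤ _
    have hs := fourier_sum (v n) z
    have hs2 := hs.sub (hasSum_ite_eq (0 : ℤ × ℤ) (co (v n) 0 * 1))
    rw [← hs2.tsum_eq]
    refine tsum_of_norm_bounded (hK.mul_left (2 * B n)) fun p => ?_
    by_cases hp : p = 0
    · subst hp
      have h1 : (e 0 : ℂ → ℂ) z = 1 := by simp [e_apply]
      have hB0 : 0 ≤ B n * ((W 0) ^ 2)⁻¹ := (norm_nonneg _).trans (H n 0)
      simp only [if_true, h1, sub_self, norm_zero]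
      linarith
    · have h1 := H n p
      have h2 : co (d^[1] (b^[0] (v n))) p = la p * co (v n) p := co_d _ _
      rw [h2, norm_mul] at h1
      have h3 := la_ge p hp
      simp only [hp, if_false, sub_zero, norm_mul, e_norm, mul_one]
      nlinarith [norm_nonneg (co (v n) p)]
  · obtain ⟨B, hB, H⟩ := sup_dec (fun n => d^[k] (b^[l] (v n))) (dec_L v h k l hkl)
    have hB2 : Summable fun n => B n * K := hB.mul_right K
    refine ⟨fun n => B n * K, hB2, fun n z => ?_⟩
    have e1 : d^[k] (b^[l] (v n - co (v n) 0 • (1 : TA))) = d^[k] (b^[l] (v n)) := by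
      rcases l with _ | l
      · rcases k with _ | k
        · simp at hkl
        · simp only [Function.iterate_zero, id, Function.iterate_succ_apply, kd]
      · simp only [Function.iterate_succ_apply, kb]
    rw [e1, ← (fourier_sum (d^[k] (b^[l] (v n))) z).tsum_eq]
    refine tsum_of_norm_bounded (hK.mul_left (B n)) fun p => ?_
    rw [norm_mul, e_norm, mul_one]
    exact H n p

lemma exists_f (μ : TA) : ∃ f : ℕ → TA, f 0 = 1 ∧ ∀ n, b (f (n + 1)) = d (μ * f n) := by
  choose T hT using solve
  exact ⟨fun n => Nat.rec 1 (fun _ x => T (μ * x)) n, rfl, fun n => hT _⟩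

lemma exists_g (μ : TA) (hμ : ∀ z, ‖(μ : ℂ → ℂ) z‖ < 1) : ∃ g : TA, b g = d μ + μ * d g := by
  obtain ⟨f, f0, hf⟩ := exists_f μ
  obtain ⟨g, hg1, hg⟩ := formal_log d b μ f f0 hf
  set v : ℕ → TA := fun n => g (n + 1) with hv
  have hgood := good_main v (dec_main μ hμ v hg)
  obtain ⟨F, -, h2, h3⟩ := hgood.sum
  refine ⟨F, ?_⟩
  have kd : ∀ n, d (v n - co (v n) 0 • (1 : TA)) = d (v n) := by
    intro n; rw [map_sub, Derivation.map_smul, Derivation.map_one_eq_zero]; simp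
  have kb : ∀ n, b (v n - co (v n) 0 • (1 : TA)) = b (v n) := by
    intro n; rw [map_sub, Derivation.map_smul, Derivation.map_one_eq_zero]; simp
  simp only [kd] at h2
  simp only [kb] at h3
  ext z
  change _ = (d μ : ℂ → ℂ) z + (μ : ℂ → ℂ) z * (d F : ℂ → ℂ) z
  have h4 := (hasSum_nat_add_iff' 1).2 (h3 z)
  have h5 := (h2 z).mul_left ((μ : ℂ → ℂ) z)
  have h6 : (fun n => (b (v (n + 1)) : ℂ → ℂ) z) = fun n => (μ : ℂ → ℂ) z * (d (v n) : ℂ → ℂ) z := by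
    ext n
    rw [hv]
    simp only [hg]
    rfl
  rw [h6] at h4
  have h7 := h4.unique h5
  simp only [Finset.sum_range_one, hv, zero_add, hg1] at h7
  linear_combination h7

lemma final (μ : ℂ → ℂ) (hμ : ContDiff ℝ (⊤ : ℕ∞) μ) (hper : DoublyPeriodic μ)
    (hbound : ∀ z : ℂ, ‖μ z‖ < 1) :
    ∃ f : ℂ → ℂ, ContDiff ℝ (⊤ : ℕ∞) f ∧ DoublyPeriodic f ∧ (∀ z : ℂ, f z ≠ 0) ∧
      ∀ z : ℂ, wderivBar f z = wderiv (fun w => μ w * f w) z := by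
  set m : TA := ⟨μ, hμ, hper⟩ with hm
  obtain ⟨g, hg⟩ := exists_g m hbound
  set F : TA := ⟨fun z => exp ((g : ℂ → ℂ) z), (smooth g).cexp,
    fun z => by simp only [per1, per2, and_self]⟩ with hF
  have hfd : ∀ z v, fderiv ℝ (F : ℂ → ℂ) z v = (F : ℂ → ℂ) z * fderiv ℝ (g : ℂ → ℂ) z v := by
    intro z v
    have := (diffb g z).hasFDerivAt.cexp.fderiv
    change fderiv ℝ (F : ℂ → ℂ) z = _ at this
    rw [this]
    rfl
  have hd : d F = F * d g := by
    ext z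
    change _ = (F : ℂ → ℂ) z * (d g : ℂ → ℂ) z
    rw [d_apply, d_apply, wderiv, wderiv, hfd, hfd]
    ring
  have hb : b F = F * b g := by
    ext z
    change _ = (F : ℂ → ℂ) z * (b g : ℂ → ℂ) z
    rw [b_apply, b_apply, wderivBar, wderivBar, hfd, hfd]
    ring
  have heq : b F = d (m * F) := by
    rw [Derivation.leibniz, hb, hg, hd]
    simp only [smul_eq_mul]
    ring
  exact ⟨F, F.2.1, F.2.2, fun z => exp_ne_zero _, fun z => congrFun (congrArg Subtype.val heq) z⟩

end UD


/-- **Existence of a nowhere vanishing uniformizing differential on the torus.**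
For `μ : ℂ → ℂ` `C^∞`, doubly periodic, with `|μ| < 1` everywhere, there is a `C^∞`
doubly periodic nowhere vanishing `f : ℂ → ℂ` with `∂f/∂z̄ = ∂(μ f)/∂z`, i.e. the
form `f (dz + μ dz̄)` is closed. -/
theorem exists_uniformizing_differential
    (μ : ℂ → ℂ) (hμ : ContDiff ℝ (⊤ : ℕ∞) μ) (hper : DoublyPeriodic μ)
    (hbound : ∀ z : ℂ, ‖μ z‖ < 1) :
    ∃ f : ℂ → ℂ, ContDiff ℝ (⊤ : ℕ∞) f ∧ DoublyPeriodic f ∧ (∀ z : ℂ, f z ≠ 0) ∧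
      ∀ z : ℂ, wderivBar f z = wderiv (fun w => μ w * f w) z := by
  
  exact UD.final μ hμ hper hbound
end

section
/- Let μ : ℂ → ℂ be a C^∞ doubly periodic function with |μ(z)| < 1 for all z, and let f : ℂ → ℂ be a C^∞ doubly periodic function with f(z) ≠ 0 for every z satisfying ∂f/∂z̄ = ∂(μ·f)/∂z on ℂ. Then the line integral Φ(z) = ∫_γ (f dζ + μ f dζ̄) along any path γ from 0 to z is independent of the path, and the resulting function Φ : ℂ → ℂ is a C^∞ diffeomorphism of ℂ onto ℂ with ∂Φ/∂z = f and ∂Φ/∂z̄ = μ·f. -/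
open MeasureTheory

open Set Topology unitInterval

/-- uniform local sections give path lifting -/
lemma aux_lift (Φ : ℂ → ℂ) (r : ℝ) (hr : 0 < r)
    (hτ : ∀ z, ∃ τ : ℂ → ℂ, ContinuousOn τ (Metric.ball (Φ z) r) ∧ τ (Φ z) = z ∧
      ∀ w ∈ Metric.ball (Φ z) r, Φ (τ w) = w)
    (γ : C(I, ℂ)) (a : ℂ) (ha : Φ a = γ 0) :
    ∃ Γ : C(I, ℂ), (∀ s, Φ (Γ s) = γ s) ∧ Γ 0 = a := by
  have huc : UniformContinuous γ := CompactSpace.uniformContinuous_of_continuous γ.continuous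
  obtain ⟨δ, hδ, hγ⟩ := Metric.uniformContinuous_iff.1 huc r hr
  let g : ℝ → ℂ := fun s => γ (projIcc 0 1 zero_le_one s)
  have hgc : Continuous g := γ.continuous.comp continuous_projIcc
  have hg : ∀ s t, |s - t| < δ → dist (g s) (g t) < r := by
    intro s t h
    refine hγ (lt_of_le_of_lt ?_ h)
    rw [Subtype.dist_eq, Real.dist_eq]
    exact abs_projIcc_sub_projIcc _
  have key : ∀ n : ℕ, ∃ Γ : ℝ → ℂ, Continuous Γ ∧ Γ 0 = a ∧
      ∀ s, 0 ≤ s → s ≤ n * (δ / 2) → Φ (Γ s) = g s := by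
    intro n
    induction n with
    | zero =>
      refine ⟨fun _ => a, continuous_const, rfl, fun s h1 h2 => ?_⟩
      have : s = 0 := le_antisymm (by simpa using h2) h1
      subst this
      simp [g, ha]
    | succ n ih =>
      obtain ⟨Γ, hc, h0, hl⟩ := ih
      set T : ℝ := n * (δ / 2) with hT
      have hT0 : 0 ≤ T := by positivity
      obtain ⟨τ, hτc, hτ0, hτl⟩ := hτ (Γ T)
      have hΦT : Φ (Γ T) = g T := hl T hT0 le_rfl
      rw [hΦT] at hτc hτ0 hτl
      let c : ℝ → ℝ := fun s => max T (min s (T + δ / 2))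
      have hcc : Continuous c := by fun_prop
      have hcm : ∀ s, g (c s) ∈ Metric.ball (g T) r := by
        intro s
        apply hg
        have h1 : T ≤ c s := le_max_left _ _
        have h2 : c s ≤ T + δ / 2 := max_le (by linarith) (min_le_right _ _)
        rw [abs_lt]; constructor <;> linarith
      refine ⟨fun s => if s ≤ T then Γ s else τ (g (c s)), ?_, ?_, ?_⟩
      · refine Continuous.if_le hc (hτc.comp_continuous (hgc.comp hcc) hcm) continuous_id
          continuous_const ?_
        rintro s rfl
        have : c T = T := by
          simp only [c]
          rw [min_eq_left (by linarith), max_self]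
        simp only [this, hτ0]
      · simp [hT0, h0]
      · intro s h1 h2
        have h3 : s ≤ T + δ / 2 := by
          push_cast at h2; rw [hT]; linarith
        by_cases h : s ≤ T
        · simp only [h, if_true]; exact hl s h1 h
        · simp only [h, if_false]
          rw [hτl _ (hcm s)]
          have : c s = s := by
            simp only [c]
            rw [min_eq_left h3, max_eq_right (by linarith)]
          rw [this]
  obtain ⟨n, hn⟩ := exists_nat_gt (1 / (δ / 2))
  obtain ⟨Γ, hc, h0, hl⟩ := key n
  refine ⟨⟨fun s => Γ s, by fun_prop⟩, fun s => ?_, by simpa using h0⟩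
  have h1 : (s : ℝ) ≤ n * (δ / 2) := by
    have := (div_lt_iff₀ (by positivity : (0:ℝ) < δ / 2)).1 hn
    linarith [s.2.2]
  have := hl s s.2.1 h1
  simpa [g] using this

lemma aux_surj (Φ : ℂ → ℂ) (r : ℝ) (hr : 0 < r)
    (hτ : ∀ z, ∃ τ : ℂ → ℂ, ContinuousOn τ (Metric.ball (Φ z) r) ∧ τ (Φ z) = z ∧
      ∀ w ∈ Metric.ball (Φ z) r, Φ (τ w) = w) : Function.Surjective Φ := by
  intro w
  obtain ⟨Γ, hl, -⟩ := aux_lift Φ r hr hτ ⟨fun s => Φ 0 + (s : ℝ) * (w - Φ 0), by fun_prop⟩ 0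
    (by simp)
  exact ⟨Γ 1, by rw [hl]; simp⟩

lemma aux_inj (Φ : ℂ → ℂ) (hloc : IsLocalHomeomorph Φ) (r : ℝ) (hr : 0 < r)
    (hτ : ∀ z, ∃ τ : ℂ → ℂ, ContinuousOn τ (Metric.ball (Φ z) r) ∧ τ (Φ z) = z ∧
      ∀ w ∈ Metric.ball (Φ z) r, Φ (τ w) = w) : Function.Injective Φ := by
  intro a b hab
  have hΦc := hloc.continuous
  let α : C(I, ℂ) := ⟨fun s => a + (s : ℝ) * (b - a), by fun_prop⟩
  let γ₀ : C(I, ℂ) := ⟨fun s => Φ (α s), by fun_prop⟩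
  let γ₁ : C(I, ℂ) := .const I (Φ a)
  let H : γ₀.HomotopyRel γ₁ {0, 1} :=
    { toFun := fun p => (1 - ((p.1 : ℝ) : ℂ)) * γ₀ p.2 + ((p.1 : ℝ) : ℂ) * Φ a
      continuous_toFun := by fun_prop
      map_zero_left := by intro s; simp
      map_one_left := by intro s; simp [γ₁]
      prop' := by
        intro t s hs
        have : γ₀ s = Φ a := by
          rcases hs with rfl | rfl
          · simp [γ₀, α]
          · simp [γ₀, α, hab]
        simp [this]; ring }
  have hH : ∀ t s, H (t, s) = (1 - ((t : ℝ) : ℂ)) * γ₀ s + ((t : ℝ) : ℂ) * Φ a := fun _ _ => rfl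
  have ex : ∀ t : I, ∃ Γ : C(I, ℂ), (∀ s, Φ (Γ s) = H (t, s)) ∧ Γ 0 = a ∧
      (t = 0 → Γ 1 = b) ∧ (t = 1 → Γ 1 = a) := by
    intro t
    by_cases h0 : t = 0
    · subst h0
      exact ⟨α, fun s => by simp [hH, γ₀], by simp [α], fun _ => by simp [α], fun h => by simp at h⟩
    by_cases h1 : t = 1
    · subst h1
      exact ⟨.const I a, fun s => by simp [hH], rfl, fun h => by simp at h, fun _ => rfl⟩
    obtain ⟨Γ, hl, hΓ⟩ := aux_lift Φ r hr hτ ⟨fun s => H (t, s), by fun_prop⟩ a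
      (by simp [hH, γ₀, α]; ring)
    exact ⟨Γ, hl, hΓ, fun h => (h0 h).elim, fun h => (h1 h).elim⟩
  choose Γ hΓ hΓ0 hb ha using ex
  have := hloc.monodromy_theorem (T2Space.isSeparatedMap Φ) H Γ hΓ
    (fun t => by rw [hΓ0, hΓ0]) 1
  rw [ha 1 rfl, hb 0 rfl] at this
  exact this

/-- uniform local sections from translation-equivariance -/
lemma aux_unif (Φ : ℂ → ℂ) (hloc : IsLocalHomeomorph Φ)
    (K : Set ℂ) (hK : IsCompact K)
    (hper : ∀ z, ∃ l c : ℂ, z - l ∈ K ∧ ∀ w, Φ (w + l) = Φ w + c) :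
    ∃ r > 0, ∀ z, ∃ τ : ℂ → ℂ, ContinuousOn τ (Metric.ball (Φ z) r) ∧ τ (Φ z) = z ∧
      ∀ w ∈ Metric.ball (Φ z) r, Φ (τ w) = w := by
  have hΦc := hloc.continuous
  have h1 : ∃ r > 0, ∀ z ∈ K, ∃ τ : ℂ → ℂ, ContinuousOn τ (Metric.ball (Φ z) r) ∧ τ (Φ z) = z ∧
      ∀ w ∈ Metric.ball (Φ z) r, Φ (τ w) = w := by
    refine hK.induction_on (p := fun S => ∃ r > 0, ∀ z ∈ S, ∃ τ : ℂ → ℂ,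
      ContinuousOn τ (Metric.ball (Φ z) r) ∧ τ (Φ z) = z ∧
      ∀ w ∈ Metric.ball (Φ z) r, Φ (τ w) = w) ⟨1, one_pos, by simp⟩ ?_ ?_ ?_
    · rintro s t hst ⟨r, hr, h⟩
      exact ⟨r, hr, fun z hz => h z (hst hz)⟩
    · rintro s t ⟨r, hr, h⟩ ⟨r', hr', h'⟩
      refine ⟨min r r', lt_min hr hr', ?_⟩
      rintro z (hz | hz)
      · obtain ⟨τ, a, b, c⟩ := h z hz
        have hs := Metric.ball_subset_ball (x := Φ z) (min_le_left r r')
        exact ⟨τ, a.mono hs, b, fun w hw => c w (hs hw)⟩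
      · obtain ⟨τ, a, b, c⟩ := h' z hz
        have hs := Metric.ball_subset_ball (x := Φ z) (min_le_right r r')
        exact ⟨τ, a.mono hs, b, fun w hw => c w (hs hw)⟩
    · intro z₀ _
      obtain ⟨e, he, rfl⟩ := hloc z₀
      obtain ⟨ρ, hρ, hb⟩ := Metric.isOpen_iff.1 e.open_target _ (e.map_source he)
      refine ⟨e.source ∩ e ⁻¹' Metric.ball (e z₀) (ρ / 2), mem_nhdsWithin_of_mem_nhds ?_,
        ρ / 2, by positivity, ?_⟩
      · exact Filter.inter_mem (e.open_source.mem_nhds he)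
          (hΦc.continuousAt.preimage_mem_nhds (Metric.ball_mem_nhds _ (by positivity)))
      · rintro z ⟨hz, hz'⟩
        have hs : Metric.ball (e z) (ρ / 2) ⊆ e.target := by
          refine Subset.trans (Metric.ball_subset_ball' ?_) hb
          have : dist (e z) (e z₀) < ρ / 2 := hz'
          linarith
        exact ⟨e.symm, e.continuousOn_symm.mono hs, e.left_inv hz, fun w hw => e.right_inv (hs hw)⟩
  obtain ⟨r, hr, h⟩ := h1
  refine ⟨r, hr, fun z => ?_⟩
  obtain ⟨l, c, hl, hc⟩ := hper z
  obtain ⟨τ, s1, s2, s3⟩ := h _ hl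
  have hz : Φ z = Φ (z - l) + c := by rw [← hc]; simp
  have hmem : ∀ w ∈ Metric.ball (Φ z) r, w - c ∈ Metric.ball (Φ (z - l)) r := by
    intro w hw
    rw [mem_ball_iff_norm] at hw ⊢
    rw [hz] at hw
    convert hw using 2; ring
  refine ⟨fun w => τ (w - c) + l, ?_, ?_, ?_⟩
  · exact (s1.comp (by fun_prop) hmem).add continuousOn_const
  · simp only [hz]; simp [s2]
  · intro w hw
    rw [hc, s3 _ (hmem w hw)]; ring

/-- the 1-form -/
noncomputable def auxForm (f g : ℂ → ℂ) (z : ℂ) : ℂ →L[ℝ] ℂ :=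
  f z • ContinuousLinearMap.id ℝ ℂ + g z • (Complex.conjCLE : ℂ →L[ℝ] ℂ)

lemma auxForm_apply (f g : ℂ → ℂ) (z v : ℂ) :
    auxForm f g z v = f z * v + g z * (starRingEnd ℂ) v := by
  simp [auxForm]

lemma aux_primitive (f g : ℂ → ℂ) (hf : ContDiff ℝ (⊤ : ℕ∞) f) (hg : ContDiff ℝ (⊤ : ℕ∞) g)
    (heq : ∀ z : ℂ, wderivBar f z = wderiv g z) :
    ∃ Φ : ℂ → ℂ, Φ 0 = 0 ∧ ∀ z, HasFDerivAt Φ (auxForm f g z) z := by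
  have hfd := hf.differentiable (by simp)
  have hgd := hg.differentiable (by simp)
  have hω : ∀ z, HasFDerivAt (auxForm f g)
      ((fderiv ℝ f z).smulRight (ContinuousLinearMap.id ℝ ℂ) +
        (fderiv ℝ g z).smulRight (Complex.conjCLE : ℂ →L[ℝ] ℂ)) z := by
    intro z
    exact ((hfd z).hasFDerivAt.smul_const _).add ((hgd z).hasFDerivAt.smul_const (Complex.conjCLE : ℂ →L[ℝ] ℂ))
  have hsym : ∀ z x y, fderiv ℝ (auxForm f g) z x y = fderiv ℝ (auxForm f g) z y x := by
    intro z x y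
    rw [(hω z).fderiv]
    have e := heq z
    simp only [wderivBar, wderiv] at e
    have dec : ∀ (L : ℂ →L[ℝ] ℂ) (v : ℂ), L v = v.re * L 1 + v.im * L Complex.I := by
      intro L v
      conv_lhs => rw [show v = v.re • (1:ℂ) + v.im • Complex.I by simp]
      rw [map_add, map_smul, map_smul]; simp
    have hc : ∀ v : ℂ, v = v.re + v.im * Complex.I := fun v => by simp
    have hcc : ∀ v : ℂ, (starRingEnd ℂ) v = v.re - v.im * Complex.I := fun v => by
      apply Complex.ext <;> simp
    simp only [ContinuousLinearMap.add_apply, ContinuousLinearMap.smulRight_apply,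
      ContinuousLinearMap.smul_apply, ContinuousLinearMap.id_apply, smul_eq_mul,
      ContinuousLinearEquiv.coe_coe, Complex.conjCLE_apply]
    rw [hcc x, hcc y, dec (fderiv ℝ f z) x, dec (fderiv ℝ f z) y, dec (fderiv ℝ g z) x,
      dec (fderiv ℝ g z) y]
    have e' : fderiv ℝ f z Complex.I = Complex.I * (fderiv ℝ f z 1 - fderiv ℝ g z 1)
        - fderiv ℝ g z Complex.I := by
      linear_combination (-2 * Complex.I) * e
        + (fderiv ℝ f z Complex.I + fderiv ℝ g z Complex.I) * Complex.I_mul_I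
    rw [e']
    generalize fderiv ℝ f z 1 = A
    generalize fderiv ℝ g z 1 = B
    generalize fderiv ℝ g z Complex.I = C
    obtain ⟨x1, x2⟩ := x
    obtain ⟨y1, y2⟩ := y
    rw [hc ⟨x1, x2⟩, hc ⟨y1, y2⟩]
    simp
    ring_nf
    try simp only [Complex.I_sq]
    try ring_nf
  obtain ⟨F, hF⟩ := convex_univ.exists_forall_hasFDerivAt_of_fderiv_symmetric isOpen_univ
    (fun z _ => (hω z).differentiableAt.differentiableWithinAt) (fun z _ => hsym z)
  exact ⟨fun z => F z - F 0, by simp, fun z => (hF z (mem_univ z)).sub_const _⟩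

lemma aux_equiv (f g : ℂ → ℂ) (z : ℂ) (h : ‖g z‖ < ‖f z‖) :
    ∃ L : ℂ ≃L[ℝ] ℂ, (L : ℂ →L[ℝ] ℂ) = auxForm f g z := by
  have hinj : Function.Injective (auxForm f g z).toLinearMap := by
    rw [injective_iff_map_eq_zero]
    intro v hv
    have hv : auxForm f g z v = 0 := hv
    rw [auxForm_apply] at hv
    by_contra hne
    have h1 : f z * v = - (g z * (starRingEnd ℂ) v) := eq_neg_of_add_eq_zero_left hv
    have h2 := congrArg norm h1
    simp only [norm_mul, norm_neg, RCLike.norm_conj] at h2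
    have : 0 < ‖v‖ := norm_pos_iff.2 hne
    nlinarith
  refine ⟨(LinearEquiv.ofInjectiveEndo _ hinj).toContinuousLinearEquiv, ?_⟩
  ext v
  rfl

lemma aux_per (f : ℂ → ℂ) (hf : DoublyPeriodic f) (m n : ℤ) (z : ℂ) :
    f (z + (m * (2 * Real.pi) + n * (2 * Real.pi * Complex.I))) = f z := by
  have h1 : Function.Periodic f (2 * Real.pi) := fun z => (hf z).1
  have h2 : Function.Periodic f (2 * Real.pi * Complex.I) := fun z => (hf z).2
  rw [← add_assoc, h2.int_mul n, h1.int_mul m]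

lemma aux_reduce (z : ℂ) : ∃ m n : ℤ,
    z - (m * (2 * Real.pi) + n * (2 * Real.pi * Complex.I)) ∈ Metric.closedBall (0:ℂ) (4 * Real.pi) := by
  have hp := Real.two_pi_pos
  refine ⟨⌊z.re / (2 * Real.pi)⌋, ⌊z.im / (2 * Real.pi)⌋, ?_⟩
  have key : ∀ x : ℝ, |x - ⌊x / (2 * Real.pi)⌋ * (2 * Real.pi)| ≤ 2 * Real.pi := by
    intro x
    have h1 := (le_div_iff₀ hp).1 (Int.floor_le (x / (2 * Real.pi)))
    have h2 := (div_lt_iff₀ hp).1 (Int.lt_floor_add_one (x / (2 * Real.pi)))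
    rw [abs_le]; constructor <;> nlinarith
  rw [mem_closedBall_zero_iff]
  refine (Complex.norm_le_abs_re_add_abs_im _).trans ?_
  have := key z.re
  have := key z.im
  have e1 : (z - (⌊z.re / (2 * Real.pi)⌋ * (2 * Real.pi) + ⌊z.im / (2 * Real.pi)⌋ * (2 * Real.pi * Complex.I))).re
      = z.re - ⌊z.re / (2 * Real.pi)⌋ * (2 * Real.pi) := by simp
  have e2 : (z - (⌊z.re / (2 * Real.pi)⌋ * (2 * Real.pi) + ⌊z.im / (2 * Real.pi)⌋ * (2 * Real.pi * Complex.I))).im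
      = z.im - ⌊z.im / (2 * Real.pi)⌋ * (2 * Real.pi) := by simp
  rw [e1, e2]
  linarith [key z.re, key z.im]

/-- **The primitive of a nowhere vanishing uniformizing differential uniformizes.**
Given `μ, f : ℂ → ℂ` `C^∞` doubly periodic with `|μ| < 1`, `f ≠ 0` everywhere and
`∂f/∂z̄ = ∂(μ f)/∂z`, the line integral `Φ(z) = ∫_γ (f dζ + μ f dζ̄)` along any `C¹`
path from `0` to `z` is independent of the path, and `Φ` is a `C^∞` diffeomorphism
of `ℂ` onto `ℂ` with `∂Φ/∂z = f` and `∂Φ/∂z̄ = μ f`. -/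
theorem primitive_of_uniformizing_differential
    (μ f : ℂ → ℂ) (hμ : ContDiff ℝ (⊤ : ℕ∞) μ) (hf : ContDiff ℝ (⊤ : ℕ∞) f)
    (hperμ : DoublyPeriodic μ) (hperf : DoublyPeriodic f)
    (hbound : ∀ z : ℂ, ‖μ z‖ < 1) (hf0 : ∀ z : ℂ, f z ≠ 0)
    (heq : ∀ z : ℂ, wderivBar f z = wderiv (fun w => μ w * f w) z) :
    ∃ Φ : ℂ → ℂ,
      (∀ (z : ℂ) (γ : ℝ → ℂ), ContDiff ℝ 1 γ → γ 0 = 0 → γ 1 = z →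
        Φ z = ∫ t in (0:ℝ)..1,
          (f (γ t) * deriv γ t + μ (γ t) * f (γ t) * (starRingEnd ℂ) (deriv γ t))) ∧
      ContDiff ℝ (⊤ : ℕ∞) Φ ∧ Function.Bijective Φ ∧
      ContDiff ℝ (⊤ : ℕ∞) (Function.invFun Φ) ∧
      ∀ z : ℂ, wderiv Φ z = f z ∧ wderivBar Φ z = μ z * f z := by
  set g : ℂ → ℂ := fun w => μ w * f w with hgdef
  have hg : ContDiff ℝ (⊤ : ℕ∞) g := hμ.mul hf
  obtain ⟨Φ, hΦ0, hΦ⟩ := aux_primitive f g hf hg heq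
  have hnorm : ∀ z, ‖g z‖ < ‖f z‖ := by
    intro z
    simp only [hgdef, norm_mul]
    have := norm_pos_iff.2 (hf0 z)
    nlinarith [hbound z]
  have hform : ContDiff ℝ (⊤ : ℕ∞) (auxForm f g) :=
    (hf.smul contDiff_const).add (hg.smul contDiff_const)
  have hsmooth : ContDiff ℝ (⊤ : ℕ∞) Φ := by
    rw [contDiff_infty_iff_fderiv]
    refine ⟨fun z => (hΦ z).differentiableAt, ?_⟩
    have : fderiv ℝ Φ = auxForm f g := funext fun z => (hΦ z).fderiv
    rw [this]; exact hform
  have hloc : IsLocalHomeomorph Φ := by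
    intro z
    obtain ⟨L, hL⟩ := aux_equiv f g z (hnorm z)
    have hs : HasStrictFDerivAt Φ (L : ℂ →L[ℝ] ℂ) z :=
      (hsmooth.contDiffAt.hasStrictFDerivAt' (by rw [hL]; exact hΦ z) (by simp))
    exact ⟨hs.toOpenPartialHomeomorph Φ, hs.mem_toOpenPartialHomeomorph_source, rfl⟩
  have hperg : DoublyPeriodic g := fun z => by
    simp only [hgdef]
    rw [(hperf z).1, (hperf z).2, (hperμ z).1, (hperμ z).2]; simp
  have hper : ∀ z, ∃ l c : ℂ, z - l ∈ Metric.closedBall (0:ℂ) (4 * Real.pi) ∧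
      ∀ w, Φ (w + l) = Φ w + c := by
    intro z
    obtain ⟨m, n, h⟩ := aux_reduce z
    set l : ℂ := m * (2 * Real.pi) + n * (2 * Real.pi * Complex.I) with hl
    refine ⟨l, Φ l - Φ 0, h, fun w => ?_⟩
    have hd : ∀ w, HasFDerivAt (fun w => Φ (w + l) - Φ w) (0 : ℂ →L[ℝ] ℂ) w := by
      intro w
      have h1 : HasFDerivAt (fun w => Φ (w + l)) (auxForm f g (w + l)) w :=
        (hasFDerivAt_comp_add_right l).2 (hΦ (w + l))
      have h2 : auxForm f g (w + l) = auxForm f g w := by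
        simp only [auxForm, hl, aux_per f hperf, aux_per g hperg]
      have := h1.sub (hΦ w)
      rwa [h2, sub_self] at this
    have hc := is_const_of_fderiv_eq_zero (𝕜 := ℝ) (fun w => (hd w).differentiableAt)
      (fun w => (hd w).fderiv) w 0
    simp only [zero_add] at hc
    rw [← hc]; ring
  obtain ⟨r, hr, hτ⟩ := aux_unif Φ hloc _ (isCompact_closedBall 0 _) hper
  have hbij : Function.Bijective Φ := ⟨aux_inj Φ hloc r hr hτ, aux_surj Φ r hr hτ⟩
  refine ⟨Φ, ?_, hsmooth, hbij, ?_, ?_⟩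
  · intro z γ hγ h0 h1
    have hd : ∀ t, HasDerivAt (fun t => Φ (γ t))
        (f (γ t) * deriv γ t + μ (γ t) * f (γ t) * (starRingEnd ℂ) (deriv γ t)) t := by
      intro t
      have := (hΦ (γ t)).comp_hasDerivAt t ((hγ.differentiable (by simp)) t).hasDerivAt
      rwa [auxForm_apply] at this
    have hdc : Continuous (deriv γ) := hγ.continuous_deriv (by simp)
    have hγc := hγ.continuous
    have hfc := hf.continuous
    have hμc := hμ.continuous
    rw [intervalIntegral.integral_eq_sub_of_hasDerivAt (fun t _ => hd t)
      (Continuous.intervalIntegrable (by fun_prop) _ _)]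
    simp [h0, h1, hΦ0]
  · let e := hloc.toHomeomorphOfBijective hbij
    have he : ∀ z, e z = Φ z := fun _ => rfl
    have hinv : Function.invFun Φ = e.symm := by
      funext w
      apply hbij.1
      rw [Function.invFun_eq (hbij.2 w), ← he, e.apply_symm_apply]
    rw [hinv]
    choose L hL using fun z => aux_equiv f g z (hnorm z)
    exact e.contDiff_symm (f₀' := L) (fun z => by rw [hL]; exact hΦ z) hsmooth
  · intro z
    have hI := Complex.I_mul_I
    constructor
    · simp only [wderiv, (hΦ z).fderiv, auxForm_apply, map_one, Complex.conj_I]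
      linear_combination (-(f z) / 2 + g z / 2) * hI
    · simp only [wderivBar, (hΦ z).fderiv, auxForm_apply, map_one, Complex.conj_I]
      simp only [hgdef]
      linear_combination ((f z) / 2 - μ z * f z / 2) * hI
end
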